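/- arXiv:2201.05084 — 5 statements merged into one kernel-verified Lean document; each statement's English description precedes it below -/
import Mathlib

section
/- The derivative of the Dirichlet beta function at s = 1, given by the convergent series β'(1) = ∑_{n=0}^∞ (−1)^{n+1} log(2n+1)/(2n+1), equals (π/4)[γ + 2 log 2 + 3 log π − 4 log Γ(1/4)]. -/
open Real Complex Filter Topology Finset

theorem sum_range_second_diff {R : Type*} [CommRing R] (a : ℕ → R) (N : ℕ) :
    ∑ k ∈ range N, (a (4 * k + 1) - 2 * a (4 * k + 3) + a (4 * k + 5)) =
      2 * ∑ k ∈ range N, (a (4 * k + 1) - a (4 * k + 3)) - a 1 + a (4 * N + 1) := by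
  induction N with
  | zero => simp
  | succ N ih => rw [sum_range_succ, ih, sum_range_succ]; ring_nf

theorem sum_range_two_mul_alternating {R : Type*} [CommRing R] (a : ℕ → R) (N : ℕ) :
    ∑ n ∈ range (2 * N), (-1) ^ n * a (2 * n + 1) =
      ∑ k ∈ range N, (a (4 * k + 1) - a (4 * k + 3)) := by
  induction N with
  | zero => simp
  | succ N ih =>
    rw [Nat.mul_succ, sum_range_succ, sum_range_succ, ih, sum_range_succ, pow_succ, pow_mul]
    ring_nf

theorem hasDerivAt_ofReal_cpow_neg {x : ℝ} (hx : 0 < x) (s : ℂ) :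
    HasDerivAt (fun y : ℝ => (y : ℂ) ^ (-s)) (-s * (x : ℂ) ^ (-s - 1)) x := by
  have := ((hasDerivAt_id (x : ℂ)).cpow_const (c := -s) (by simp [hx])).comp_ofReal
  simpa using this

theorem norm_cpow_second_diff_le {x : ℝ} (hx : 0 < x) {s : ℂ} (hs : -2 ≤ s.re) :
    ‖(x : ℂ) ^ (-s) - 2 * ((x + 2 : ℝ) : ℂ) ^ (-s) + ((x + 4 : ℝ) : ℂ) ^ (-s)‖ ≤
      4 * (‖s‖ * ‖s + 1‖) * x ^ (-s.re - 2) := by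
  have hfirst : ∀ y ∈ Set.Ici x, ‖-s * ((y + 2 : ℝ) : ℂ) ^ (-s - 1) - -s * (y : ℂ) ^ (-s - 1)‖ ≤
      2 * (‖s‖ * ‖s + 1‖) * x ^ (-s.re - 2) := by
    intro y hy
    have hy0 : 0 < y := hx.trans_le hy
    have := (convex_Ici x).norm_image_sub_le_of_norm_hasDerivWithin_le (𝕜 := ℝ)
      (f := fun y : ℝ => -s * (y : ℂ) ^ (-(s + 1)))
      (f' := fun y => -s * (-(s + 1) * (y : ℂ) ^ (-(s + 1) - 1)))
      (C := ‖s‖ * ‖s + 1‖ * x ^ (-s.re - 2)) (x := y) (y := y + 2)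
      (fun z hz => ((hasDerivAt_ofReal_cpow_neg (hx.trans_le hz) _).const_mul _).hasDerivWithinAt)
      (fun z hz => by
        rw [norm_mul, norm_mul, norm_neg, norm_neg, Complex.norm_cpow_eq_rpow_re_of_pos
          (hx.trans_le hz), ← mul_assoc]
        gcongr
        have : (-(s + 1) - 1).re = -s.re - 2 := by simp; ring
        rw [this]
        exact Real.rpow_le_rpow_of_nonpos hx hz (by linarith))
      hy (Set.mem_Ici.2 (by linarith [Set.mem_Ici.1 hy]))
    have h2 : ‖y + 2 - y‖ = 2 := by norm_num
    rw [h2, show -(s + 1) = -s - 1 by ring] at this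
    linarith
  have := (convex_Ici x).norm_image_sub_le_of_norm_hasDerivWithin_le (𝕜 := ℝ)
    (f := fun y : ℝ => ((y + 2 : ℝ) : ℂ) ^ (-s) - (y : ℂ) ^ (-s))
    (x := x) (y := x + 2)
    (fun z hz => (((hasDerivAt_ofReal_cpow_neg
      (by linarith [hx.trans_le hz] : 0 < z + 2) s).comp_add_const z 2).sub
      (hasDerivAt_ofReal_cpow_neg (hx.trans_le hz) s)).hasDerivWithinAt) hfirst
      (Set.mem_Ici.2 le_rfl) (Set.mem_Ici.2 (by linarith))
  have h2 : ‖x + 2 - x‖ = 2 := by norm_num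
  rw [h2, show x + 2 + 2 = x + 4 by ring] at this
  calc _ = ‖((x + 4 : ℝ) : ℂ) ^ (-s) - ((x + 2 : ℝ) : ℂ) ^ (-s) -
        (((x + 2 : ℝ) : ℂ) ^ (-s) - (x : ℂ) ^ (-s))‖ := by congr 1; ring
    _ ≤ _ := this
    _ = _ := by ring

/-- The second difference of `n ↦ n⁻ˢ` on `4k + 1`, `4k + 3`, `4k + 5`; it is `O(k ^ (-s - 2))`. -/
noncomputable def betaTerm (k : ℕ) (s : ℂ) : ℂ :=
  ((4 * k + 1 : ℕ) : ℂ) ^ (-s) - 2 * ((4 * k + 3 : ℕ) : ℂ) ^ (-s) + ((4 * k + 5 : ℕ) : ℂ) ^ (-s)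

theorem hasDerivAt_natCast_cpow_neg {n : ℕ} (hn : n ≠ 0) (s : ℂ) :
    HasDerivAt (fun s : ℂ => (n : ℂ) ^ (-s)) (-((n : ℂ) ^ (-s) * (Real.log n : ℝ))) s := by
  have := (hasDerivAt_neg s).const_cpow (c := (n : ℂ)) (Or.inl (by exact_mod_cast hn))
  simpa [Complex.natCast_log] using this

theorem hasDerivAt_betaTerm (k : ℕ) (s : ℂ) :
    HasDerivAt (betaTerm k)
      (-(((4 * k + 1 : ℕ) : ℂ) ^ (-s) * (Real.log (4 * k + 1 : ℕ) : ℝ)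
        - 2 * (((4 * k + 3 : ℕ) : ℂ) ^ (-s) * (Real.log (4 * k + 3 : ℕ) : ℝ))
        + ((4 * k + 5 : ℕ) : ℂ) ^ (-s) * (Real.log (4 * k + 5 : ℕ) : ℝ))) s := by
  convert! ((hasDerivAt_natCast_cpow_neg (n := 4 * k + 1) (by simp) s).sub
    ((hasDerivAt_natCast_cpow_neg (n := 4 * k + 3) (by simp) s).const_mul 2)).add
    (hasDerivAt_natCast_cpow_neg (n := 4 * k + 5) (by simp) s) using 1
  ring

/-- A ball containing `0` and `1`, and points of real part greater than `1`. -/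
abbrev betaBall : Set ℂ := Metric.ball (1 / 2) (9 / 10)

theorem norm_betaTerm_le (k : ℕ) {s : ℂ} (hs : s ∈ betaBall) :
    ‖betaTerm k s‖ ≤ 16 * ((k + 1 : ℕ) : ℝ) ^ (-3 / 2 : ℝ) := by
  have h : ‖s - 1 / 2‖ < 9 / 10 := by simpa [dist_eq_norm] using hs
  have hre : -(2 / 5) ≤ s.re := by
    have := (abs_le.1 ((Complex.abs_re_le_norm _).trans h.le)).1
    norm_num at this ⊢
    linarith
  have h0 : ‖s‖ ≤ 7 / 5 := by
    calc ‖s‖ = ‖(s - 1 / 2) + 1 / 2‖ := by ring_nf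
      _ ≤ ‖s - 1 / 2‖ + ‖(1 / 2 : ℂ)‖ := norm_add_le _ _
      _ ≤ _ := by norm_num at h ⊢; linarith
  have h1 : ‖s + 1‖ ≤ 12 / 5 := by
    calc ‖s + 1‖ ≤ ‖s‖ + ‖(1 : ℂ)‖ := norm_add_le _ _
      _ ≤ _ := by norm_num at h0 ⊢; linarith
  have hb := norm_cpow_second_diff_le (x := 4 * k + 1) (by positivity) (s := s) (by linarith)
  have hpow : ((4 * k + 1 : ℝ)) ^ (-s.re - 2) ≤ ((k + 1 : ℕ) : ℝ) ^ (-3 / 2 : ℝ) := by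
    calc ((4 * k + 1 : ℝ)) ^ (-s.re - 2) ≤ ((4 * k + 1 : ℝ)) ^ (-3 / 2 : ℝ) :=
        Real.rpow_le_rpow_of_exponent_le (by simp) (by linarith)
      _ ≤ _ := Real.rpow_le_rpow_of_nonpos (by positivity)
        (by push_cast; linarith [k.cast_nonneg (α := ℝ)]) (by norm_num)
  calc ‖betaTerm k s‖ = _ := by
        rw [betaTerm]; congr 1; push_cast; ring_nf
    _ ≤ _ := hb
    _ ≤ 4 * (7 / 5 * (12 / 5)) * ((k + 1 : ℕ) : ℝ) ^ (-3 / 2 : ℝ) := by gcongr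
    _ ≤ _ := by gcongr; norm_num

theorem summable_betaTerm_bound :
    Summable fun k : ℕ => 16 * ((k + 1 : ℕ) : ℝ) ^ (-3 / 2 : ℝ) :=
  ((summable_nat_add_iff 1).2 (Real.summable_nat_rpow.2 (by norm_num))).mul_left 16

/-- The Dirichlet beta function, given by a series that converges absolutely for `Re s > -1`. -/
noncomputable def betaAux (s : ℂ) : ℂ := (1 + ∑' k, betaTerm k s) / 2

theorem differentiableOn_betaAux : DifferentiableOn ℂ betaAux betaBall :=
  ((differentiableOn_tsum_of_summable_norm summable_betaTerm_bound
    (fun k s _ => (hasDerivAt_betaTerm k s).differentiableAt.differentiableWithinAt)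
    Metric.isOpen_ball (fun k _ hs => norm_betaTerm_le k hs)).const_add 1).div_const 2

theorem hasSum_deriv_betaTerm {s : ℂ} (hs : s ∈ betaBall) :
    HasSum (fun k => deriv (betaTerm k) s) (2 * deriv betaAux s) := by
  have h := hasSum_deriv_of_summable_norm summable_betaTerm_bound
    (fun k s _ => (hasDerivAt_betaTerm k s).differentiableAt.differentiableWithinAt)
    Metric.isOpen_ball (fun k _ hs => norm_betaTerm_le k hs) hs
  have hd : deriv betaAux s = deriv (fun w => ∑' k, betaTerm k w) s / 2 := by
    rw [show betaAux = fun s => (1 + ∑' k, betaTerm k s) / 2 from rfl, deriv_div_const,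
      deriv_const_add]
  rwa [hd, mul_div_cancel₀ _ two_ne_zero]

theorem betaAux_zero : betaAux 0 = 1 / 2 := by
  have : ∀ k, betaTerm k 0 = 0 := fun k => by simp [betaTerm]; norm_num
  simp [betaAux, this]

/-- If the paired partial sums of the beta series converge, their limit is `betaAux`. -/
theorem eq_betaAux_of_tendsto {s c : ℂ} (hs : s ∈ betaBall) (hs0 : 0 < s.re)
    (h : Tendsto (fun N => ∑ k ∈ range N,
      (((4 * k + 1 : ℕ) : ℂ) ^ (-s) - ((4 * k + 3 : ℕ) : ℂ) ^ (-s))) atTop (𝓝 c)) :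
    c = betaAux s := by
  have hsum := (summable_betaTerm_bound.of_norm_bounded
    (fun k => norm_betaTerm_le k hs)).hasSum.tendsto_sum_nat
  have hlim : Tendsto (fun N : ℕ => ((4 * N + 1 : ℕ) : ℂ) ^ (-s)) atTop (𝓝 0) := by
    rw [tendsto_zero_iff_norm_tendsto_zero]
    have h4 : Tendsto (fun N : ℕ => ((4 * N + 1 : ℕ) : ℝ)) atTop atTop :=
      tendsto_natCast_atTop_atTop.comp
        (tendsto_atTop_mono (fun N => by simp only [id]; omega) tendsto_id)
    refine ((tendsto_rpow_neg_atTop hs0).comp h4).congr fun N => ?_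
    rw [Complex.norm_natCast_cpow_of_pos (by omega)]
    simp
  have h2 := ((h.const_mul 2).sub_const 1).add hlim
  have := tendsto_nhds_unique (h2.congr fun N => ?_) hsum
  · rw [betaAux, ← this]; ring
  · have := sum_range_second_diff (fun n : ℕ => (n : ℂ) ^ (-s)) N
    simp only [betaTerm]
    rw [this]; simp

/-- An entire function that agrees with the beta series for `Re s > 1` agrees with `betaAux`. -/
theorem betaAux_eqOn {g : ℂ → ℂ} (hg : Differentiable ℂ g)
    (h : ∀ s : ℂ, 1 < s.re → Tendsto (fun N => ∑ k ∈ range N,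
      (((4 * k + 1 : ℕ) : ℂ) ^ (-s) - ((4 * k + 3 : ℕ) : ℂ) ^ (-s))) atTop (𝓝 (g s))) :
    Set.EqOn g betaAux betaBall := by
  have hmem : (6 / 5 : ℂ) ∈ betaBall := by
    rw [Metric.mem_ball, dist_eq_norm]; norm_num
  refine (hg.differentiableOn.analyticOnNhd Metric.isOpen_ball
    ).eqOn_of_preconnected_of_eventuallyEq
    (differentiableOn_betaAux.analyticOnNhd Metric.isOpen_ball)
    (convex_ball _ _).isPreconnected hmem ?_
  have hre : ∀ᶠ s : ℂ in 𝓝 (6 / 5), 1 < s.re :=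
    Complex.continuous_re.continuousAt.eventually_const_lt (by norm_num)
  filter_upwards [hre, Metric.isOpen_ball.mem_nhds hmem] with s hs hs'
  exact eq_betaAux_of_tendsto hs' (by linarith) (h s hs)

theorem betaAux_eqOn_sinZeta :
    Set.EqOn (HurwitzZeta.sinZeta ((1 / 4 : ℝ) : UnitAddCircle)) betaAux betaBall := by
  refine betaAux_eqOn (HurwitzZeta.differentiableAt_sinZeta _) fun s hs => ?_
  have h := (HurwitzZeta.hasSum_nat_sinZeta (1 / 4) hs).tendsto_sum_nat.comp
    (tendsto_id.const_mul_atTop' (r := 4) (by norm_num))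
  refine h.congr fun N => ?_
  simp only [Function.comp, id]
  induction N with
  | zero => simp
  | succ N ih =>
    have e (j : ℕ) : Real.sin (2 * π * (1 / 4) * ((4 * N + j : ℕ) : ℝ)) =
        Real.sin (j * (π / 2)) := by
      rw [← Real.sin_add_nat_mul_two_pi (j * (π / 2)) N]; push_cast; ring_nf
    have e0 := e 0
    have e1 := e 1
    have e2 := e 2
    have e3 := e 3
    rw [show ((3 : ℕ) : ℝ) * (π / 2) = π / 2 + π by push_cast; ring, Real.sin_add_pi] at e3
    simp only [Nat.cast_zero, zero_mul, Real.sin_zero, add_zero] at e0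
    simp only [Nat.cast_one, one_mul, Real.sin_pi_div_two] at e1 e3
    rw [show ((2 : ℕ) : ℝ) * (π / 2) = π by push_cast; ring, Real.sin_pi] at e2
    rw [Nat.mul_succ, sum_range_succ _ (4 * N + 3), sum_range_succ _ (4 * N + 2),
      sum_range_succ _ (4 * N + 1), sum_range_succ _ (4 * N), ih, sum_range_succ, e0, e1, e2, e3]
    simp only [Complex.cpow_neg]
    push_cast
    ring

theorem betaAux_eqOn_hurwitzZetaOdd :
    Set.EqOn (fun s => 2 * (4 : ℂ) ^ (-s) *
      HurwitzZeta.hurwitzZetaOdd ((1 / 4 : ℝ) : UnitAddCircle) s) betaAux betaBall := by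
  refine betaAux_eqOn ?_ fun s hs => ?_
  · refine Differentiable.mul (fun s => ?_) (HurwitzZeta.differentiable_hurwitzZetaOdd _)
    have := hasDerivAt_natCast_cpow_neg (n := 4) (by simp) s
    exact (this.differentiableAt.const_mul 2)
  have h := ((HurwitzZeta.hasSum_nat_hurwitzZetaOdd_of_mem_Icc (a := 1 / 4)
    ⟨by norm_num, by norm_num⟩ hs).mul_left (2 * (4 : ℂ) ^ (-s))).tendsto_sum_nat
  refine h.congr fun N => sum_congr rfl fun k _ => ?_
  have e (x : ℝ) (hx : 0 < x) : ((4 * x : ℝ) : ℂ) ^ (-s) = 4 ^ (-s) * (1 / (x : ℂ) ^ s) := by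
    rw [Complex.ofReal_mul, Complex.mul_cpow_ofReal_nonneg (by norm_num) hx.le,
      Complex.cpow_neg (x : ℂ), one_div, Complex.ofReal_ofNat]
  have e1 := e (k + 1 / 4) (by positivity)
  have e3 := e (k + 1 - 1 / 4) (by linarith [k.cast_nonneg (α := ℝ)])
  rw [show (4 * (k + 1 / 4) : ℝ) = ((4 * k + 1 : ℕ) : ℝ) by push_cast; ring,
    Complex.ofReal_natCast] at e1
  rw [show (4 * (k + 1 - 1 / 4) : ℝ) = ((4 * k + 3 : ℕ) : ℝ) by push_cast; ring,
    Complex.ofReal_natCast] at e3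
  rw [e1, e3]
  push_cast
  ring

theorem deriv_betaAux_zero :
    deriv betaAux 0 = ((Real.log (Real.Gamma (1 / 4)) - Real.log (Real.Gamma (3 / 4))
      - Real.log 2 : ℝ) : ℂ) := by
  have h := (hasSum_deriv_betaTerm (s := 0) (by
    rw [Metric.mem_ball, dist_eq_norm]; norm_num)).tendsto_sum_nat
  have hG := (BohrMollerup.tendsto_log_gamma (x := 1 / 4) (by norm_num)).sub
    (BohrMollerup.tendsto_log_gamma (x := 3 / 4) (by norm_num))
  have hlog : Tendsto (fun n : ℕ => Real.log n - Real.log (4 * n + 5)) atTop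
      (𝓝 (-Real.log 4)) := by
    have := ((Real.tendsto_log_comp_add_sub_log (5 / 4)).comp
      tendsto_natCast_atTop_atTop).neg.sub_const (Real.log 4)
    rw [neg_zero, zero_sub] at this
    refine this.congr fun n => ?_
    rw [show (4 * n + 5 : ℝ) = 4 * (n + 5 / 4) by ring,
      Real.log_mul (by norm_num) (by positivity)]
    simp only [Function.comp]
    ring
  have hR := ((hG.const_mul 2).add hlog)
  have hC := (Complex.continuous_ofReal.tendsto _).comp hR
  have h1 := h.comp (tendsto_add_atTop_nat 1)
  have := tendsto_nhds_unique_of_eventuallyEq h1 hC ?_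
  · have h4 : Real.log 4 = 2 * Real.log 2 := by
      rw [show (4 : ℝ) = 2 ^ 2 by norm_num, Real.log_pow]; norm_num
    rw [h4] at this
    rw [← mul_right_inj' (two_ne_zero (α := ℂ)), this]
    push_cast
    ring
  · filter_upwards [eventually_gt_atTop 0] with n hn
    simp only [Function.comp, BohrMollerup.logGammaSeq]
    have e (k : ℕ) : Real.log (1 / 4 + k) - Real.log (3 / 4 + k) =
        Real.log (4 * k + 1 : ℕ) - Real.log (4 * k + 3 : ℕ) := by
      have hk := k.cast_nonneg (α := ℝ)
      rw [show ((4 * k + 1 : ℕ) : ℝ) = 4 * (1 / 4 + k) by push_cast; ring,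
        show ((4 * k + 3 : ℕ) : ℝ) = 4 * (3 / 4 + k) by push_cast; ring,
        Real.log_mul (by norm_num) (by positivity), Real.log_mul (by norm_num) (by positivity)]
      ring
    have hs := sum_range_second_diff (fun n : ℕ => Real.log n) (n + 1)
    simp only [← e, sum_sub_distrib] at hs
    have hd (k : ℕ) : deriv (betaTerm k) 0 = ((-(Real.log (4 * k + 1 : ℕ)
        - 2 * Real.log (4 * k + 3 : ℕ) + Real.log (4 * k + 5 : ℕ)) : ℝ) : ℂ) := by
      rw [(hasDerivAt_betaTerm k 0).deriv]
      simp
    simp only [hd]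
    rw [← Complex.ofReal_sum, sum_neg_distrib, hs,
      show ((4 * (n + 1) + 1 : ℕ) : ℝ) = 4 * n + 5 by push_cast; ring, Nat.cast_one, Real.log_one]
    congr 1
    ring

theorem hasDerivAt_betaAux_one :
    HasDerivAt betaAux ((π / 4 * (Real.eulerMascheroniConstant + 2 * Real.log 2 + 3 * Real.log π
          - 4 * Real.log (Real.Gamma (1 / 4))) : ℝ) : ℂ) 1 := by
  have m0 : (0 : ℂ) ∈ betaBall := by rw [Metric.mem_ball, dist_eq_norm]; norm_num
  have m1 : (1 : ℂ) ∈ betaBall := by rw [Metric.mem_ball, dist_eq_norm]; norm_num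
  have hd {s : ℂ} (hs : s ∈ betaBall) : HasDerivAt betaAux (deriv betaAux s) s :=
    (differentiableOn_betaAux.differentiableAt (Metric.isOpen_ball.mem_nhds hs)).hasDerivAt
  -- The functional equation relating `betaAux (1 - s)` and `betaAux s`, to be differentiated at `1`.
  have hfe : ∀ᶠ s in 𝓝 (1 : ℂ), (4 : ℂ) ^ (-(-(1 - s))) * betaAux (1 - s) =
      4 * (2 * π : ℂ) ^ (-s) * Complex.Gamma s * Complex.sin (π * s / 2) * betaAux s := by
    have hre : ∀ᶠ s : ℂ in 𝓝 1, 0 < s.re :=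
      Complex.continuous_re.continuousAt.eventually_const_lt (by norm_num)
    have hm : ∀ᶠ s : ℂ in 𝓝 1, 1 - s ∈ betaBall :=
      (continuous_const.sub continuous_id).continuousAt.eventually_mem
        (Metric.isOpen_ball.mem_nhds (by simpa using m0))
    filter_upwards [hre, hm, Metric.isOpen_ball.mem_nhds m1] with s hs hs1 hs2
    have := HurwitzZeta.hurwitzZetaOdd_one_sub ((1 / 4 : ℝ) : UnitAddCircle) (s := s)
      (fun n h => by
        rw [h] at hs
        simp at hs
        linarith [n.cast_nonneg (α := ℝ)])
    rw [betaAux_eqOn_sinZeta hs2] at this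
    have h1 := betaAux_eqOn_hurwitzZetaOdd hs1
    simp only [this] at h1
    rw [← h1, Complex.cpow_neg _ (-(1 - s))]
    have : (4 : ℂ) ^ (-(1 - s)) ≠ 0 := by simp [Complex.cpow_eq_zero_iff]
    field_simp
    ring
  have hπ : (π : ℂ) ≠ 0 := by exact_mod_cast Real.pi_ne_zero
  have hL1 : betaAux 1 = π / 4 := by
    have := hfe.self_of_nhds
    simp [betaAux_zero, Complex.cpow_neg_one] at this
    field_simp at this
    rw [this]
    ring
  have hlog4 : Complex.log 4 = 2 * (Real.log 2 : ℝ) := by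
    rw [show (4 : ℂ) = ((4 : ℕ) : ℂ) by norm_num, ← Complex.natCast_log,
      show ((4 : ℕ) : ℝ) = 2 ^ 2 by norm_num, Real.log_pow]
    push_cast
    ring
  have hlog2π : Complex.log (2 * π) = (Real.log 2 : ℝ) + (Real.log π : ℝ) := by
    rw [show (2 * π : ℂ) = ((2 * π : ℝ) : ℂ) by push_cast; ring,
      ← Complex.ofReal_log (by positivity), Real.log_mul (by norm_num) Real.pi_ne_zero]
    push_cast
    ring
  have hΓ : Real.log (Real.Gamma (3 / 4)) =
      Real.log π + Real.log 2 / 2 - Real.log (Real.Gamma (1 / 4)) := by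
    have h := congrArg Real.log (Real.Gamma_mul_Gamma_one_sub (1 / 4))
    rw [show (1 - 1 / 4 : ℝ) = 3 / 4 by norm_num, mul_one_div, Real.sin_pi_div_four,
      Real.log_mul (Real.Gamma_pos_of_pos (by norm_num)).ne'
        (Real.Gamma_pos_of_pos (by norm_num)).ne',
      Real.log_div Real.pi_ne_zero (by positivity), Real.log_div (by positivity) (by norm_num),
      Real.log_sqrt (by norm_num)] at h
    linarith
  have hl : HasDerivAt (fun s : ℂ => (4 : ℂ) ^ (-(-(1 - s))) * betaAux (1 - s))
      (-(Complex.log 4 * (1 / 2)) - deriv betaAux 0) 1 := by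
    have hsub := (hasDerivAt_id (1 : ℂ)).const_sub 1
    have hp := hsub.neg.neg.const_cpow (c := 4) (Or.inl (by norm_num))
    have hb : HasDerivAt betaAux (deriv betaAux 0) (1 - id (1 : ℂ)) := by simpa using hd m0
    convert! hp.mul (hb.comp (1 : ℂ) hsub) using 1
    simp [betaAux_zero]
    ring
  have hr : HasDerivAt (fun s : ℂ => 4 * (2 * π : ℂ) ^ (-s) * Complex.Gamma s *
      Complex.sin (π * s / 2) * betaAux s)
      (2 / π * (-(Complex.log (2 * π) + Real.eulerMascheroniConstant) * (π / 4)
        + deriv betaAux 1)) 1 := by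
    have hp := ((hasDerivAt_neg (1 : ℂ)).const_cpow (c := 2 * π)
      (Or.inl (mul_ne_zero two_ne_zero hπ))).const_mul 4
    have hsin := (((hasDerivAt_id (1 : ℂ)).const_mul (π : ℂ)).div_const 2).csin
    convert! ((hp.mul Complex.hasDerivAt_Gamma_one).mul hsin).mul (hd m1) using 1
    simp [hL1, Complex.cpow_neg_one]
    field_simp
    ring
  have heq := hl.unique (hr.congr_of_eventuallyEq hfe)
  rw [deriv_betaAux_zero, hlog4, hlog2π, hΓ] at heq
  convert! hd m1 using 1
  push_cast at heq ⊢
  field_simp at heq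
  linear_combination heq / 16

/-- The convergent series
`β'(1) = ∑_{n=0}^∞ (-1)^{n+1} log(2n+1)/(2n+1)` (the derivative of the Dirichlet beta
function at `s = 1`) equals `(π/4)[γ + 2 log 2 + 3 log π - 4 log Γ(1/4)]`. -/
theorem dirichletBeta_deriv_one :
    Tendsto (fun N : ℕ => ∑ n ∈ range N,
        (-1 : ℝ) ^ (n + 1) * Real.log (2 * n + 1) / (2 * n + 1)) atTop
      (𝓝 ((π / 4) * (Real.eulerMascheroniConstant + 2 * Real.log 2 + 3 * Real.log π
          - 4 * Real.log (Real.Gamma (1 / 4))))) := by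
  set c := (π / 4) * (Real.eulerMascheroniConstant + 2 * Real.log 2 + 3 * Real.log π
    - 4 * Real.log (Real.Gamma (1 / 4))) with hc
  have hzero : Tendsto (fun n : ℕ => Real.log n / n) atTop (𝓝 0) := by
    have := Real.isLittleO_log_id_atTop.tendsto_div_nhds_zero.comp
      (tendsto_natCast_atTop_atTop (R := ℝ))
    exact this
  have hterm : Tendsto (fun N : ℕ => Real.log (4 * N + 1 : ℕ) / (4 * N + 1 : ℕ)) atTop (𝓝 0) :=
    hzero.comp (tendsto_atTop_mono (fun N => by simp only [id]; omega) tendsto_id)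
  have hd (k : ℕ) : deriv (betaTerm k) 1 =
      ((-(Real.log (4 * k + 1 : ℕ) / (4 * k + 1 : ℕ)
        - 2 * (Real.log (4 * k + 3 : ℕ) / (4 * k + 3 : ℕ))
        + Real.log (4 * k + 5 : ℕ) / (4 * k + 5 : ℕ)) : ℝ) : ℂ) := by
    rw [(hasDerivAt_betaTerm k 1).deriv]
    simp only [Complex.cpow_neg_one]
    push_cast
    ring
  have hsum := hasSum_deriv_betaTerm (s := 1) (by
    rw [Metric.mem_ball, dist_eq_norm]; norm_num)
  rw [hasDerivAt_betaAux_one.deriv, ← hc] at hsum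
  simp only [hd] at hsum
  rw [show (2 * c : ℂ) = ((2 * c : ℝ) : ℂ) by push_cast; ring, Complex.hasSum_ofReal] at hsum
  have heven : Tendsto (fun N : ℕ => ∑ n ∈ range (2 * N),
      (-1 : ℝ) ^ (n + 1) * Real.log (2 * n + 1) / (2 * n + 1)) atTop (𝓝 c) := by
    have := (hsum.tendsto_sum_nat.add hterm).div_const 2
    rw [add_zero, mul_div_cancel_left₀ _ two_ne_zero] at this
    refine this.congr fun N => ?_
    have h1 := sum_range_second_diff (fun n : ℕ => Real.log n / n) N
    have h2 := sum_range_two_mul_alternating (fun n : ℕ => Real.log n / n) N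
    rw [sum_neg_distrib, h1, ← h2, Nat.cast_one, Real.log_one]
    have h3 : ∑ n ∈ range (2 * N), (-1 : ℝ) ^ (n + 1) * Real.log (2 * n + 1) / (2 * n + 1) =
        -∑ n ∈ range (2 * N),
          (-1 : ℝ) ^ n * (Real.log ((2 * n + 1 : ℕ) : ℝ) / ((2 * n + 1 : ℕ) : ℝ)) := by
      rw [← sum_neg_distrib]
      refine sum_congr rfl fun n _ => ?_
      push_cast
      ring
    rw [h3]
    ring
  have hodd : Tendsto (fun N : ℕ => ∑ n ∈ range (2 * N + 1),
      (-1 : ℝ) ^ (n + 1) * Real.log (2 * n + 1) / (2 * n + 1)) atTop (𝓝 c) := by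
    have := heven.sub hterm
    rw [sub_zero] at this
    refine this.congr fun N => ?_
    rw [sum_range_succ, pow_succ, pow_mul]
    push_cast
    ring_nf
  rw [tendsto_atTop'] at heven hodd ⊢
  intro s hs
  obtain ⟨a, ha⟩ := heven s hs
  obtain ⟨b, hb⟩ := hodd s hs
  refine ⟨2 * a + 2 * b + 1, fun n hn => ?_⟩
  obtain ⟨m, rfl | rfl⟩ := n.even_or_odd'
  · exact ha m (by omega)
  · exact hb m (by omega)
end

section
/- The series ∑_{n=1}^∞ (log n / n) cos(2nπ/3) converges and equals (1/2)(γ − (1/2) log 3) log 3, where γ is the Euler–Mascheroni constant. -/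
open Real Complex Filter Topology Finset

lemma exists_log_sq_sub_log_sq_eq {a b : ℝ} (ha : 0 < a) (hab : a < b) :
    ∃ c ∈ Set.Ioo a b,
      Real.log b ^ 2 / 2 - Real.log a ^ 2 / 2 = Real.log c / c * (b - a) := by
  have hderiv : ∀ x : ℝ, 0 < x →
      HasDerivAt (fun y : ℝ => Real.log y ^ 2 / 2) (Real.log x / x) x := by
    intro x hx
    refine (((Real.hasDerivAt_log hx.ne').pow 2).div_const 2).congr_deriv ?_
    norm_num
    ring
  obtain ⟨c, hc, h⟩ := exists_hasDerivAt_eq_slope (fun y : ℝ => Real.log y ^ 2 / 2)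
    (fun x => Real.log x / x) hab
    (fun x hx => (hderiv x (ha.trans_le hx.1)).continuousAt.continuousWithinAt)
    (fun x hx => hderiv x (ha.trans hx.1))
  refine ⟨c, hc, ?_⟩
  have hba : b - a ≠ 0 := (sub_pos.2 hab).ne'
  rw [h, div_mul_cancel₀ _ hba]

lemma log_sq_succ_sub_log_sq_bounds {x : ℝ} (hx : 3 ≤ x) :
    Real.log (x + 1) / (x + 1) ≤ Real.log (x + 1) ^ 2 / 2 - Real.log x ^ 2 / 2 ∧
      Real.log (x + 1) ^ 2 / 2 - Real.log x ^ 2 / 2 ≤ Real.log x / x := by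
  obtain ⟨c, hc, h⟩ := exists_log_sq_sub_log_sq_eq (by linarith : 0 < x) (lt_add_one x)
  have he : Real.exp 1 ≤ x := by linarith [Real.exp_one_lt_d9]
  have hec : Real.exp 1 ≤ c := he.trans hc.1.le
  rw [h, add_sub_cancel_left, mul_one]
  exact ⟨Real.log_div_self_antitoneOn hec (hec.trans hc.2.le) hc.2.le,
    Real.log_div_self_antitoneOn he hec hc.1.le⟩

lemma exists_tendsto_sum_log_div_sub_log_sq :
    ∃ l : ℝ, Tendsto (fun N : ℕ =>
      ∑ n ∈ range N, Real.log (n + 1) / (n + 1) - Real.log N ^ 2 / 2) atTop (𝓝 l) := by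
  set D : ℕ → ℝ := fun N =>
    ∑ n ∈ range N, Real.log (n + 1) / (n + 1) - Real.log N ^ 2 / 2 with hD
  have hcast (k : ℕ) : (3 : ℝ) ≤ ((k + 3 : ℕ) : ℝ) := by
    push_cast; linarith [k.cast_nonneg (α := ℝ)]
  have hanti : Antitone fun k => D (k + 3) := by
    refine antitone_nat_of_succ_le fun k => ?_
    have h := (log_sq_succ_sub_log_sq_bounds (hcast k)).1
    have e : k + 1 + 3 = (k + 3) + 1 := by ring
    simp only [hD]
    rw [e, sum_range_succ, Nat.cast_succ (k + 3)]
    linarith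
  have hmono : Monotone fun k : ℕ =>
      D (k + 3) - Real.log ((k + 3 : ℕ) : ℝ) / ((k + 3 : ℕ) : ℝ) := by
    refine monotone_nat_of_le_succ fun k => ?_
    have h := (log_sq_succ_sub_log_sq_bounds (hcast k)).2
    have e : k + 1 + 3 = (k + 3) + 1 := by ring
    simp only [hD]
    rw [e, sum_range_succ _ (k + 3), Nat.cast_succ (k + 3)]
    linarith
  have hbdd : BddBelow (Set.range fun k => D (k + 3)) := by
    refine ⟨D (0 + 3) - Real.log ((0 + 3 : ℕ) : ℝ) / ((0 + 3 : ℕ) : ℝ), ?_⟩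
    rintro _ ⟨k, rfl⟩
    have h := hmono (Nat.zero_le k)
    have hpos : 0 ≤ Real.log ((k + 3 : ℕ) : ℝ) / ((k + 3 : ℕ) : ℝ) :=
      div_nonneg (Real.log_natCast_nonneg _) (Nat.cast_nonneg _)
    simp only at h ⊢
    linarith
  exact ⟨_, (tendsto_add_atTop_iff_nat 3).1 (tendsto_atTop_ciInf hanti hbdd)⟩

lemma cos_two_pi_third_values (k : ℕ) :
    Real.cos (2 * (((3 * k : ℕ) : ℝ) + 1) * π / 3) = -(1 / 2) ∧
    Real.cos (2 * (((3 * k + 1 : ℕ) : ℝ) + 1) * π / 3) = -(1 / 2) ∧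
    Real.cos (2 * (((3 * k + 2 : ℕ) : ℝ) + 1) * π / 3) = 1 := by
  refine ⟨?_, ?_, ?_⟩
  · have e : 2 * (((3 * k : ℕ) : ℝ) + 1) * π / 3 = π - π / 3 + k * (2 * π) := by
      push_cast; ring
    rw [e, Real.cos_add_nat_mul_two_pi, Real.cos_pi_sub, Real.cos_pi_div_three]
  · have e : 2 * (((3 * k + 1 : ℕ) : ℝ) + 1) * π / 3 = π / 3 + π + k * (2 * π) := by
      push_cast; ring
    rw [e, Real.cos_add_nat_mul_two_pi, Real.cos_add_pi, Real.cos_pi_div_three]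
  · have e : 2 * (((3 * k + 2 : ℕ) : ℝ) + 1) * π / 3 = ((k + 1 : ℕ) : ℝ) * (2 * π) := by
      push_cast; ring
    rw [e, Real.cos_nat_mul_two_pi]

lemma sum_range_three_mul_log_div_mul_cos (M : ℕ) :
    ∑ n ∈ range (3 * M), Real.log (n + 1) / (n + 1) * Real.cos (2 * (n + 1) * π / 3) =
      -(1 / 2) * ∑ n ∈ range (3 * M), Real.log (n + 1) / (n + 1) +
        1 / 2 * ∑ n ∈ range M, Real.log (n + 1) / (n + 1) +
        1 / 2 * Real.log 3 * (harmonic M : ℝ) := by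
  induction M with
  | zero => simp
  | succ k ih =>
    obtain ⟨h0, h1, h2⟩ := cos_two_pi_third_values k
    have e : 3 * (k + 1) = 3 * k + 1 + 1 + 1 := by ring
    have hk : (k : ℝ) + 1 ≠ 0 := by positivity
    have hlog : Real.log (((3 * k + 2 : ℕ) : ℝ) + 1) / (((3 * k + 2 : ℕ) : ℝ) + 1) =
        1 / 3 * (Real.log 3 * ((k : ℝ) + 1)⁻¹ + Real.log (k + 1) / (k + 1)) := by
      have e3 : ((3 * k + 2 : ℕ) : ℝ) + 1 = 3 * (k + 1) := by push_cast; ring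
      rw [e3, Real.log_mul (by norm_num) hk]
      field_simp
    rw [e]
    simp only [sum_range_succ, harmonic_succ]
    rw [ih, h0, h1, h2, hlog]
    push_cast
    ring

lemma tendsto_of_tendsto_three_mul {α : Type*} {u : ℕ → α} {f : Filter α}
    (h0 : Tendsto (fun k => u (3 * k)) atTop f)
    (h1 : Tendsto (fun k => u (3 * k + 1)) atTop f)
    (h2 : Tendsto (fun k => u (3 * k + 2)) atTop f) : Tendsto u atTop f := by
  intro s hs
  obtain ⟨K, hK⟩ := eventually_atTop.1
    ((h0.eventually hs).and ((h1.eventually hs).and (h2.eventually hs)))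
  refine mem_map.2 (mem_atTop_sets.2 ⟨3 * K, fun N hN => ?_⟩)
  obtain ⟨g0, g1, g2⟩ := hK (N / 3) (by omega)
  have hN3 : N = 3 * (N / 3) ∨ N = 3 * (N / 3) + 1 ∨ N = 3 * (N / 3) + 2 := by omega
  rw [Set.mem_preimage]
  rcases hN3 with h | h | h <;> rw [h] <;> assumption

lemma tendsto_log_div_mul_cos_zero :
    Tendsto (fun n : ℕ => Real.log (n + 1) / (n + 1) * Real.cos (2 * (n + 1) * π / 3))
      atTop (𝓝 0) := by
  have h : Tendsto (fun x : ℝ => Real.log x / x) atTop (𝓝 0) :=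
    Real.isLittleO_log_id_atTop.tendsto_div_nhds_zero
  have h' : Tendsto (fun n : ℕ => Real.log ((n : ℝ) + 1) / ((n : ℝ) + 1)) atTop (𝓝 0) :=
    h.comp (tendsto_atTop_add_const_right _ 1 tendsto_natCast_atTop_atTop)
  refine squeeze_zero_norm (fun n => ?_) (norm_zero (E := ℝ) ▸ h'.norm)
  rw [norm_mul]
  exact mul_le_of_le_one_right (norm_nonneg _) (Real.abs_cos_le_one _)

/-- The series `∑_{n=1}^∞ (log n / n) cos(2nπ/3)` converges and equals
`(1/2)(γ - (1/2) log 3) log 3`. -/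
theorem sum_log_div_cos_two_pi_third :
    Tendsto (fun N : ℕ => ∑ n ∈ range N,
        Real.log (n + 1) / (n + 1) * Real.cos (2 * (n + 1) * π / 3)) atTop
      (𝓝 ((1 / 2) * (Real.eulerMascheroniConstant - (1 / 2) * Real.log 3) * Real.log 3)) := by
  have h3 : Tendsto (fun k : ℕ => 3 * k) atTop atTop :=
    tendsto_id.const_mul_atTop' (by norm_num)
  have hmain : Tendsto (fun k : ℕ => ∑ n ∈ range (3 * k),
        Real.log (n + 1) / (n + 1) * Real.cos (2 * (n + 1) * π / 3)) atTop
      (𝓝 ((1 / 2) * (Real.eulerMascheroniConstant - (1 / 2) * Real.log 3) * Real.log 3)) := by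
    obtain ⟨l, hl⟩ := exists_tendsto_sum_log_div_sub_log_sq
    have hlim := (((hl.comp h3).const_mul (-(1 / 2))).add (hl.const_mul (1 / 2))).add
      ((Real.tendsto_harmonic_sub_log.const_mul (1 / 2 * Real.log 3)).sub_const
        (1 / 4 * Real.log 3 ^ 2))
    have hval : -(1 / 2) * l + 1 / 2 * l + (1 / 2 * Real.log 3 * Real.eulerMascheroniConstant -
        1 / 4 * Real.log 3 ^ 2) =
        (1 / 2) * (Real.eulerMascheroniConstant - (1 / 2) * Real.log 3) * Real.log 3 := by ring
    rw [hval] at hlim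
    refine hlim.congr' ?_
    filter_upwards [eventually_gt_atTop 0] with k hk
    have hk' : (k : ℝ) ≠ 0 := by exact_mod_cast hk.ne'
    rw [sum_range_three_mul_log_div_mul_cos]
    simp only [Function.comp_apply]
    rw [Nat.cast_mul, Nat.cast_ofNat, Real.log_mul (by norm_num) hk']
    ring
  have hmain1 := hmain.add (tendsto_log_div_mul_cos_zero.comp h3)
  have hmain2 := hmain1.add
    (tendsto_log_div_mul_cos_zero.comp ((tendsto_add_atTop_nat 1).comp h3))
  simp only [add_zero] at hmain1 hmain2
  refine tendsto_of_tendsto_three_mul hmain (hmain1.congr fun k => ?_) (hmain2.congr fun k => ?_)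
  · rw [sum_range_succ]; rfl
  · rw [sum_range_succ, sum_range_succ]; rfl
end

section
/- The series ∑_{n=1}^∞ (log²n / n) cos(2nπ/3) converges and 2 ∑_{n=1}^∞ (log²n / n) cos(2nπ/3) = −(1/3) log³3 + γ log²3 + 2γ₁ log 3, where γ is the Euler–Mascheroni constant and γ₁ is the first Stieltjes constant. -/
open Real Complex Filter Topology Finset

theorem norm_cpow_neg_sub_cpow_neg_le {a b : ℝ} (ha : 0 < a) (hab : a ≤ b) {s : ℂ}
    (hs : 0 ≤ s.re) :
    ‖(b : ℂ) ^ (-s) - (a : ℂ) ^ (-s)‖ ≤ ‖s‖ * a ^ (-s.re - 1) * (b - a) := by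
  refine norm_image_sub_le_of_norm_deriv_le_segment' (f := fun x : ℝ => (x : ℂ) ^ (-s))
    (f' := fun x : ℝ => -s * (x : ℂ) ^ (-s - 1)) (fun x hx => ?_) (fun x hx => ?_) b ⟨hab, le_rfl⟩
  · have hx0 : (x : ℂ) ∈ slitPlane := ofReal_mem_slitPlane.2 (ha.trans_le hx.1)
    simpa using ((hasDerivAt_id (x : ℂ)).cpow_const (c := -s) hx0).comp_ofReal.hasDerivWithinAt
  · have hx0 : 0 < x := ha.trans_le hx.1
    rw [norm_mul, norm_neg, norm_cpow_eq_rpow_re_of_pos hx0]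
    gcongr
    simpa using Real.rpow_le_rpow_of_nonpos ha hx.1 (by simp; linarith : (-s - 1).re ≤ 0)

/-- The contribution of `n = 3k + 1, 3k + 2, 3k + 3` to `∑ cos (2πn/3) n⁻ˢ`. -/
noncomputable def cosZetaBlock (k : ℕ) (s : ℂ) : ℂ :=
  ((3 * k + 3 : ℕ) : ℂ) ^ (-s)
    - (((3 * k + 1 : ℕ) : ℂ) ^ (-s) + ((3 * k + 2 : ℕ) : ℂ) ^ (-s)) / 2

theorem norm_cosZetaBlock_le (k : ℕ) {s : ℂ} (hs : s ∈ Metric.ball (1 : ℂ) (1 / 2)) :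
    ‖cosZetaBlock k s‖ ≤ 9 / 4 * (1 / |(k : ℝ) + 1| ^ (3 / 2 : ℝ)) := by
  rw [Metric.mem_ball, dist_eq_norm] at hs
  have hre : 1 / 2 ≤ s.re := by
    have := (abs_le.1 ((abs_re_le_norm (s - 1)).trans hs.le)).1
    simp at this
    linarith
  have hnorm : ‖s‖ ≤ 3 / 2 := by
    have := norm_add_le (s - 1) 1
    simp at this
    linarith
  have key (j : ℕ) (hj : 1 ≤ j) (hj3 : j ≤ 3) :
      ‖((3 * k + 3 : ℕ) : ℂ) ^ (-s) - ((3 * k + j : ℕ) : ℂ) ^ (-s)‖ ≤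
        3 / 2 * (1 / |(k : ℝ) + 1| ^ (3 / 2 : ℝ)) * (3 - j) := by
    have hj' : (1 : ℝ) ≤ j := by exact_mod_cast hj
    have hj3' : (j : ℝ) ≤ 3 := by exact_mod_cast hj3
    have hk : (0 : ℝ) ≤ k := k.cast_nonneg
    have h := norm_cpow_neg_sub_cpow_neg_le (a := (3 * k + j : ℕ)) (b := (3 * k + 3 : ℕ))
      (by push_cast; linarith) (by push_cast; linarith) (s := s) (by linarith)
    rw [ofReal_natCast, ofReal_natCast] at h
    refine h.trans ?_
    have hpow : ((3 * k + j : ℕ) : ℝ) ^ (-s.re - 1) ≤ 1 / |(k : ℝ) + 1| ^ (3 / 2 : ℝ) := by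
      rw [abs_of_pos (by linarith), one_div, ← Real.rpow_neg (by linarith)]
      calc ((3 * k + j : ℕ) : ℝ) ^ (-s.re - 1) ≤ ((k : ℝ) + 1) ^ (-s.re - 1) :=
            Real.rpow_le_rpow_of_nonpos (by linarith) (by push_cast; linarith) (by linarith)
        _ ≤ _ := Real.rpow_le_rpow_of_exponent_le (by linarith) (by linarith)
    have hlen : ((3 * k + 3 : ℕ) : ℝ) - (3 * k + j : ℕ) = 3 - j := by push_cast; ring
    rw [hlen]
    have : (0 : ℝ) ≤ 3 - j := by linarith
    gcongr
  have h1 := key 1 le_rfl (by norm_num)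
  have h2 := key 2 (by norm_num) (by norm_num)
  have hsplit : cosZetaBlock k s =
      (((3 * k + 3 : ℕ) : ℂ) ^ (-s) - ((3 * k + 1 : ℕ) : ℂ) ^ (-s)) / 2
      + (((3 * k + 3 : ℕ) : ℂ) ^ (-s) - ((3 * k + 2 : ℕ) : ℂ) ^ (-s)) / 2 := by
    rw [cosZetaBlock]; ring
  rw [hsplit]
  refine (norm_add_le _ _).trans ?_
  rw [norm_div, norm_div, RCLike.norm_ofNat]
  norm_num at h1 h2 ⊢
  linarith

theorem summable_cosZetaBlock_bound :
    Summable fun k : ℕ => 9 / 4 * (1 / |(k : ℝ) + 1| ^ (3 / 2 : ℝ)) :=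
  ((Real.summable_one_div_nat_add_rpow 1 (3 / 2)).2 (by norm_num)).mul_left _

theorem differentiable_natCast_cpow_neg {n : ℕ} (hn : n ≠ 0) :
    Differentiable ℂ fun s : ℂ => (n : ℂ) ^ (-s) := fun s =>
  (differentiable_neg s).const_cpow (Or.inl (by exact_mod_cast hn))

theorem differentiable_cosZetaBlock (k : ℕ) : Differentiable ℂ (cosZetaBlock k) := by
  have h (j : ℕ) (hj : j ≠ 0) := differentiable_natCast_cpow_neg (n := 3 * k + j) (by omega)
  exact (h 3 (by simp)).sub (((h 1 (by simp)).add (h 2 (by simp))).div_const 2)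

theorem iteratedDeriv_two_natCast_cpow_neg {n : ℕ} (hn : n ≠ 0) (s : ℂ) :
    iteratedDeriv 2 (fun s : ℂ => (n : ℂ) ^ (-s)) s = (Real.log n : ℂ) ^ 2 * (n : ℂ) ^ (-s) := by
  have h0 : (n : ℂ) ≠ 0 := by exact_mod_cast hn
  have h : (fun s : ℂ => (n : ℂ) ^ (-s)) = fun s => cexp (-(Real.log n : ℂ) * s) := by
    ext s
    rw [cpow_def_of_ne_zero h0, ← natCast_log]
    ring_nf
  rw [h, iteratedDeriv_cexp_const_mul]
  simp [cpow_def_of_ne_zero h0]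

theorem iteratedDeriv_two_cosZetaBlock (k : ℕ) :
    iteratedDeriv 2 (cosZetaBlock k) 1 =
      (Real.log (3 * k + 3 : ℕ) ^ 2 / (3 * k + 3 : ℕ)
        - (Real.log (3 * k + 1 : ℕ) ^ 2 / (3 * k + 1 : ℕ)
          + Real.log (3 * k + 2 : ℕ) ^ 2 / (3 * k + 2 : ℕ)) / 2 : ℝ) := by
  have h (j : ℕ) (hj : j ≠ 0) : ContDiffAt ℂ 2 (fun s : ℂ => ((3 * k + j : ℕ) : ℂ) ^ (-s)) 1 :=
    (differentiable_natCast_cpow_neg (n := 3 * k + j) (by omega)).contDiff.contDiffAt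
  have h3 := h 3 (by simp)
  have h1 := h 1 (by simp)
  have h2 := h 2 (by simp)
  unfold cosZetaBlock
  rw [iteratedDeriv_fun_sub h3 ((h1.add h2).div_const 2), iteratedDeriv_div_const,
    iteratedDeriv_fun_add h1 h2]
  simp only [iteratedDeriv_two_natCast_cpow_neg (Nat.succ_ne_zero _), cpow_neg_one]
  push_cast
  ring_nf

theorem sum_range_three_mul_cos (f : ℕ → ℝ) (K : ℕ) :
    ∑ n ∈ range (3 * K), f n * Real.cos (2 * (n + 1) * π / 3) =
      ∑ k ∈ range K, (f (3 * k + 2) - (f (3 * k) + f (3 * k + 1)) / 2) := by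
  have h1 (k : ℕ) : Real.cos (2 * ((3 * k : ℕ) + 1) * π / 3) = -1 / 2 := by
    rw [show (2 * ((3 * k : ℕ) + 1) * π / 3 : ℝ) = (π - π / 3) + k * (2 * π) by push_cast; ring,
      Real.cos_add_nat_mul_two_pi, Real.cos_pi_sub, Real.cos_pi_div_three]
    norm_num
  have h2 (k : ℕ) : Real.cos (2 * ((3 * k + 1 : ℕ) + 1) * π / 3) = -1 / 2 := by
    rw [show (2 * ((3 * k + 1 : ℕ) + 1) * π / 3 : ℝ) = (π / 3 + π) + k * (2 * π) by
        push_cast; ring,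
      Real.cos_add_nat_mul_two_pi, Real.cos_add_pi, Real.cos_pi_div_three]
    norm_num
  have h3 (k : ℕ) : Real.cos (2 * ((3 * k + 2 : ℕ) + 1) * π / 3) = 1 := by
    rw [show (2 * ((3 * k + 2 : ℕ) + 1) * π / 3 : ℝ) = ((k + 1 : ℕ) : ℝ) * (2 * π) by
        push_cast; ring, Real.cos_nat_mul_two_pi]
  induction K with
  | zero => simp
  | succ K ih =>
    rw [show 3 * (K + 1) = 3 * K + 1 + 1 + 1 by ring, sum_range_succ, sum_range_succ,
      sum_range_succ, ih, sum_range_succ, h1, h2, h3]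
    ring

theorem sum_cosZetaBlock (K : ℕ) (s : ℂ) :
    ∑ k ∈ range K, cosZetaBlock k s =
      3 / 2 * 3 ^ (-s) * ∑ k ∈ range K, 1 / ((k : ℂ) + 1) ^ s
        - 1 / 2 * ∑ n ∈ range (3 * K), 1 / ((n : ℂ) + 1) ^ s := by
  induction K with
  | zero => simp
  | succ K ih =>
    have h : ((3 * K + 3 : ℕ) : ℂ) ^ (-s) = 3 ^ (-s) * ((K : ℂ) + 1) ^ (-s) := by
      rw [show 3 * K + 3 = 3 * (K + 1) by ring]
      have := natCast_mul_natCast_cpow 3 (K + 1) (-s)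
      push_cast at this ⊢
      exact this
    rw [show 3 * (K + 1) = 3 * K + 1 + 1 + 1 by ring, sum_range_succ, ih, sum_range_succ,
      sum_range_succ, sum_range_succ, sum_range_succ, cosZetaBlock]
    have h' : ((3 * K + 1 + 1 : ℕ) + 1 : ℂ) = (3 * K + 3 : ℕ) := by push_cast; ring
    have h'' : ((3 * K + 1 : ℕ) + 1 : ℂ) = (3 * K + 2 : ℕ) := by push_cast; ring
    have h''' : ((3 * K : ℕ) + 1 : ℂ) = (3 * K + 1 : ℕ) := by push_cast; ring
    rw [h', h'', h''']
    simp only [one_div, ← cpow_neg]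
    rw [h]
    ring

theorem hasSum_zeta_nat_add_one {s : ℂ} (hs : 1 < s.re) :
    HasSum (fun n : ℕ => 1 / ((n : ℂ) + 1) ^ s) (riemannZeta s) := by
  rw [zeta_eq_tsum_one_div_nat_add_one_cpow hs]
  refine Summable.hasSum ?_
  have := (summable_nat_add_iff 1).2 (Complex.summable_one_div_nat_cpow.2 hs)
  simpa using this

theorem tsum_cosZetaBlock_of_one_lt_re {s : ℂ} (hs : s ∈ Metric.ball (1 : ℂ) (1 / 2))
    (hs1 : 1 < s.re) :
    ∑' k, cosZetaBlock k s = (3 / 2 * 3 ^ (-s) - 1 / 2) * riemannZeta s := by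
  have hsum : Summable fun k => cosZetaBlock k s :=
    summable_cosZetaBlock_bound.of_norm_bounded fun k => norm_cosZetaBlock_le k hs
  have hz := (hasSum_zeta_nat_add_one hs1).tendsto_sum_nat
  have h3 : Tendsto (fun K : ℕ => 3 * K) atTop atTop :=
    tendsto_id.const_mul_atTop' (by norm_num)
  refine tendsto_nhds_unique hsum.hasSum.tendsto_sum_nat ?_
  simp only [sum_cosZetaBlock]
  rw [sub_mul]
  exact (hz.const_mul (3 / 2 * 3 ^ (-s))).sub ((hz.comp h3).const_mul (1 / 2))

theorem sub_one_mul_tsum_cosZetaBlock :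
    Set.EqOn (fun s => (s - 1) * ∑' k, cosZetaBlock k s)
      (fun s => (3 / 2 * 3 ^ (-s) - 1 / 2) * riemannZeta₁ s) (Metric.ball (1 : ℂ) (1 / 2)) := by
  have hG : DifferentiableOn ℂ (fun s => ∑' k, cosZetaBlock k s) (Metric.ball (1 : ℂ) (1 / 2)) :=
    differentiableOn_tsum_of_summable_norm summable_cosZetaBlock_bound
      (fun k => (differentiable_cosZetaBlock k).differentiableOn) Metric.isOpen_ball
      fun k s hs => norm_cosZetaBlock_le k hs
  have h3 : Differentiable ℂ fun s : ℂ => (3 : ℂ) ^ (-s) := by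
    exact_mod_cast differentiable_natCast_cpow_neg (n := 3) (by simp)
  have hmem : (5 / 4 : ℂ) ∈ Metric.ball (1 : ℂ) (1 / 2) := by
    rw [Metric.mem_ball, dist_eq_norm]
    norm_num
  refine AnalyticOnNhd.eqOn_of_preconnected_of_eventuallyEq (𝕜 := ℂ) (z₀ := 5 / 4)
    (DifferentiableOn.analyticOnNhd (by fun_prop) Metric.isOpen_ball)
    (Differentiable.differentiableOn (by fun_prop) |>.analyticOnNhd Metric.isOpen_ball)
    (convex_ball _ _).isPreconnected hmem ?_
  have hre : ∀ᶠ s : ℂ in 𝓝 (5 / 4), 1 < s.re :=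
    (isOpen_lt continuous_const continuous_re).mem_nhds (by norm_num)
  filter_upwards [Metric.isOpen_ball.mem_nhds hmem, hre] with s hs hs1
  have hne : s ≠ 1 := by rintro rfl; simp at hs1
  rw [tsum_cosZetaBlock_of_one_lt_re hs hs1, riemannZeta_eq_inv_sub_mul hne]
  field_simp [sub_ne_zero.2 hne]

theorem iteratedDeriv_two_tsum_cosZetaBlock :
    2 * iteratedDeriv 2 (fun s => ∑' k, cosZetaBlock k s) 1 =
      -(1 / 3) * (Real.log 3 : ℂ) ^ 3 + Real.eulerMascheroniConstant * (Real.log 3 : ℂ) ^ 2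
        - iteratedDeriv 2 riemannZeta₁ 1 * Real.log 3 := by
  have hmem : (1 : ℂ) ∈ Metric.ball (1 : ℂ) (1 / 2) := Metric.mem_ball_self (by norm_num)
  have hG : ContDiffAt ℂ 3 (fun s => ∑' k, cosZetaBlock k s) 1 :=
    ((differentiableOn_tsum_of_summable_norm summable_cosZetaBlock_bound
      (fun k => (differentiable_cosZetaBlock k).differentiableOn) Metric.isOpen_ball
      fun k s hs => norm_cosZetaBlock_le k hs).analyticOnNhd Metric.isOpen_ball 1 hmem).contDiffAt
  have hexp : (fun s : ℂ => (3 / 2 * 3 ^ (-s) - 1 / 2 : ℂ)) =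
      fun s => 3 / 2 * cexp (-(Real.log 3 : ℂ) * s) - 1 / 2 := by
    ext s
    rw [cpow_def_of_ne_zero (by norm_num), ofReal_log (by norm_num)]
    push_cast
    ring_nf
  have hE : ContDiffAt ℂ 3 (fun s : ℂ => (3 / 2 * 3 ^ (-s) - 1 / 2 : ℂ)) 1 := by
    rw [hexp]; fun_prop
  have hval : cexp (-(Real.log 3 : ℂ)) = 1 / 3 := by
    rw [← ofReal_neg, ← ofReal_exp, Real.exp_neg, Real.exp_log (by norm_num)]
    norm_num
  have hEd (n : ℕ) (hn : n ≠ 0) : iteratedDeriv n (fun s : ℂ => (3 / 2 * 3 ^ (-s) - 1 / 2 : ℂ)) 1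
      = 1 / 2 * (-(Real.log 3 : ℂ)) ^ n := by
    rw [hexp, iteratedDeriv_fun_sub (by fun_prop) (by fun_prop), iteratedDeriv_const_mul_field,
      iteratedDeriv_cexp_const_mul, iteratedDeriv_const]
    simp only [hn, if_false, mul_one, hval]
    ring
  have hZ : ContDiffAt ℂ 3 riemannZeta₁ 1 := differentiable_riemannZeta₁.contDiff.contDiffAt
  have hI (n : ℕ) : iteratedDeriv n (fun s : ℂ => s - 1) 1 = if n = 1 then 1 else 0 := by
    rcases n with _ | _ | n
    · simp
    · simp [iteratedDeriv_one]
    · rw [iteratedDeriv_succ', iteratedDeriv_succ']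
      simp
  have h := (sub_one_mul_tsum_cosZetaBlock.eventuallyEq_of_mem
    (Metric.isOpen_ball.mem_nhds hmem)).iteratedDeriv_eq 3
  rw [iteratedDeriv_fun_mul (by fun_prop) hG, iteratedDeriv_fun_mul hE hZ] at h
  simp only [sum_range_succ, range_zero, sum_empty, hI, hEd 1 one_ne_zero, hEd 2 two_ne_zero,
    hEd 3 three_ne_zero] at h
  norm_num [Nat.choose, iteratedDeriv_one, cpow_neg] at h
  rw [ofReal_log (by norm_num), ofReal_ofNat]
  linear_combination (2 / 3 : ℂ) * h

theorem tendsto_of_tendsto_three_mul_add {X : Type*} {u : ℕ → X} {l : Filter X}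
    (h : ∀ r < 3, Tendsto (fun n => u (3 * n + r)) atTop l) : Tendsto u atTop l := by
  intro s hs
  have h' (r : ℕ) (hr : r < 3) := eventually_atTop.1 ((h r hr).eventually hs)
  obtain ⟨a, ha⟩ := h' 0 (by norm_num)
  obtain ⟨b, hb⟩ := h' 1 (by norm_num)
  obtain ⟨c, hc⟩ := h' 2 (by norm_num)
  refine mem_atTop_sets.2 ⟨3 * (a + b + c), fun n hn => ?_⟩
  have hn' := Nat.div_add_mod n 3
  have hlt := Nat.mod_lt n (by norm_num : 3 > 0)
  rw [Set.mem_preimage, ← hn']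
  interval_cases n % 3
  · exact ha _ (by omega)
  · exact hb _ (by omega)
  · exact hc _ (by omega)

theorem tendsto_sum_iteratedDeriv_two_cosZetaBlock :
    Tendsto (fun K : ℕ => ∑ k ∈ range K, iteratedDeriv 2 (cosZetaBlock k) 1) atTop
      (𝓝 (iteratedDeriv 2 (fun s => ∑' k, cosZetaBlock k s) 1)) := by
  have hmem : (1 : ℂ) ∈ Metric.ball (1 : ℂ) (1 / 2) := Metric.mem_ball_self (by norm_num)
  have hd (K : ℕ) : Differentiable ℂ fun s => ∑ k ∈ range K, cosZetaBlock k s :=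
    Differentiable.fun_sum fun k _ => differentiable_cosZetaBlock k
  have h := ((tendstoUniformlyOn_tsum_nat summable_cosZetaBlock_bound
    fun k s hs => norm_cosZetaBlock_le k hs).tendstoLocallyUniformlyOn.deriv
      (.of_forall fun K => (hd K).differentiableOn) Metric.isOpen_ball).deriv
      (.of_forall fun K => (hd K).deriv.differentiableOn) Metric.isOpen_ball
  convert h.tendsto_at hmem using 2 with K
  · rw [← iteratedDeriv_fun_sum fun k _ => (differentiable_cosZetaBlock k).contDiff.contDiffAt,
      iteratedDeriv_succ, iteratedDeriv_one]
    rfl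
  · rw [iteratedDeriv_succ, iteratedDeriv_one]

theorem tendsto_log_sq_div_nat :
    Tendsto (fun n : ℕ => Real.log (n + 1) ^ 2 / (n + 1)) atTop (𝓝 0) := by
  have h := (isLittleO_pow_log_id_atTop (n := 2)).tendsto_div_nhds_zero.comp
    (tendsto_natCast_atTop_atTop.comp (tendsto_add_atTop_nat 1))
  simpa [Function.comp_def] using h

theorem update_sub_one_mul_riemannZeta :
    Function.update (fun s : ℂ => (s - 1) * riemannZeta s) 1 1 = riemannZeta₁ := by
  ext s
  rcases eq_or_ne s 1 with rfl | hs
  · simp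
  · rw [Function.update_of_ne hs, riemannZeta_eq_inv_sub_mul hs,
      mul_inv_cancel_left₀ (sub_ne_zero.2 hs)]

/-- The series `∑_{n=1}^∞ (log²n / n) cos(2nπ/3)` converges, and twice
its sum equals `-(1/3) log³3 + γ log²3 + 2γ₁ log 3`, where `γ₁` is the first Stieltjes
constant, `γ₁ = -(1/2) · d²/ds²[(s-1)ζ(s)]` at `s = 1` (the removable singularity of
`(s-1)ζ(s)` at `s = 1` being filled in with its limiting value `1`). -/
theorem sum_sq_log_div_cos_two_pi_third :
    ∃ L : ℝ,
      Tendsto (fun N : ℕ => ∑ n ∈ range N,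
          Real.log (n + 1) ^ 2 / (n + 1) * Real.cos (2 * (n + 1) * π / 3)) atTop (𝓝 L)
      ∧ (2 * L : ℂ)
          = ((-(1 / 3) * Real.log 3 ^ 3
              + Real.eulerMascheroniConstant * Real.log 3 ^ 2 : ℝ) : ℂ)
            + 2 * (-(1 / 2 : ℂ) * iteratedDeriv 2
                (Function.update (fun s : ℂ => (s - 1) * riemannZeta s) 1 1) 1)
              * (Real.log 3 : ℝ) := by
  set S : ℕ → ℝ := fun N => ∑ n ∈ range N,
    Real.log (n + 1) ^ 2 / (n + 1) * Real.cos (2 * (n + 1) * π / 3) with hS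
  set D := iteratedDeriv 2 (fun s => ∑' k, cosZetaBlock k s) 1 with hD
  have hblocks (K : ℕ) :
      ∑ k ∈ range K, iteratedDeriv 2 (cosZetaBlock k) 1 = (S (3 * K) : ℂ) := by
    rw [hS]
    dsimp only
    rw [sum_range_three_mul_cos (fun n => Real.log (n + 1) ^ 2 / (n + 1)), ofReal_sum]
    refine sum_congr rfl fun k _ => ?_
    rw [iteratedDeriv_two_cosZetaBlock]
    push_cast
    ring_nf
  have hlim : Tendsto (fun K => (S (3 * K) : ℂ)) atTop (𝓝 D) := by
    simpa only [hblocks] using tendsto_sum_iteratedDeriv_two_cosZetaBlock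
  have h0 : Tendsto (fun K => S (3 * K)) atTop (𝓝 D.re) := by
    simpa [Function.comp_def] using (continuous_re.tendsto D).comp hlim
  have hDre : (D.re : ℂ) = D :=
    tendsto_nhds_unique ((continuous_ofReal.tendsto _).comp h0) hlim
  have hterm : Tendsto (fun n : ℕ =>
      Real.log (n + 1) ^ 2 / (n + 1) * Real.cos (2 * (n + 1) * π / 3)) atTop (𝓝 0) :=
    tendsto_log_sq_div_nat.zero_mul_isBoundedUnder_le
      (isBoundedUnder_of ⟨1, fun n => Real.abs_cos_le_one _⟩)
  have h3 (r : ℕ) : Tendsto (fun K : ℕ => 3 * K + r) atTop atTop :=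
    tendsto_atTop_mono (fun K => by simp; omega) tendsto_id
  have h1 : Tendsto (fun K => S (3 * K + 1)) atTop (𝓝 D.re) := by
    simpa [hS, sum_range_succ] using h0.add (hterm.comp (h3 0))
  have h2 : Tendsto (fun K => S (3 * K + 2)) atTop (𝓝 D.re) := by
    simpa [hS, sum_range_succ] using h1.add (hterm.comp (h3 1))
  refine ⟨D.re, tendsto_of_tendsto_three_mul_add fun r hr => ?_, ?_⟩
  · interval_cases r
    exacts [h0, h1, h2]
  · rw [hDre, hD, iteratedDeriv_two_tsum_cosZetaBlock, update_sub_one_mul_riemannZeta]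
    push_cast
    ring
end

section
/- (Kummer's Fourier series for log Γ) For 0 < u < 1, log Γ(u) = (1/2) log π + (1/π) ∑_{n=1}^∞ (log n) sin(2πnu)/n − (u − 1/2)(γ + log(2π)) − (1/2) log sin(πu), where the series converges. -/
section

open Filter Topology MeasureTheory

section CosineIntegral

/-- A Riemann–Lebesgue lemma for cosine coefficients on a bounded interval. -/
lemma tendsto_intervalIntegral_cos_mul {g : ℝ → ℝ} {a b : ℝ} (hab : a ≤ b)
    (hg : IntervalIntegrable g volume a b) {c : ℝ} (hc : 0 < c) :
    Tendsto (fun K : ℕ => ∫ x in a..b, Real.cos (c * K * x) * g x) atTop (𝓝 0) := by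
  have hRL := Real.tendsto_integral_exp_smul_cocompact
    ((Set.Ioc a b).indicator fun x => (g x : ℂ))
  have hw : Tendsto (fun K : ℕ => c / (2 * Real.pi) * (K : ℝ)) atTop (cocompact ℝ) :=
    (tendsto_natCast_atTop_atTop.const_mul_atTop (by positivity)).mono_right
      atTop_le_cocompact
  have h := (Complex.continuous_re.tendsto _).comp (hRL.comp hw)
  rw [Complex.zero_re] at h
  refine h.congr fun K => ?_
  have hgi : Integrable ((Set.Ioc a b).indicator fun x => (g x : ℂ)) := by
    rw [integrable_indicator_iff measurableSet_Ioc]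
    exact ((intervalIntegrable_iff_integrableOn_Ioc_of_le hab).1 hg).ofReal
  simp only [Function.comp_apply]
  rw [intervalIntegral.integral_of_le hab, ← integral_indicator measurableSet_Ioc,
    ← RCLike.re_eq_complex_re, ← integral_re]
  · refine integral_congr_ae (Eventually.of_forall fun x => ?_)
    by_cases hx : x ∈ Set.Ioc a b
    · simp only [Set.indicator_of_mem hx, Circle.smul_def, Real.fourierChar_apply, smul_eq_mul,
        RCLike.re_eq_complex_re, Complex.re_mul_ofReal, Complex.exp_ofReal_mul_I_re]
      congr 1
      rw [← Real.cos_neg]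
      congr 1
      field_simp
    · simp [Set.indicator_of_notMem hx]
  · simpa [mul_comm] using
      (Real.fourierIntegral_convergent_iff (c / (2 * Real.pi) * (K : ℝ))).2 hgi

lemma sin_mul_sum_sin_odd (θ : ℝ) (K : ℕ) :
    Real.sin θ * ∑ k ∈ Finset.range K, 2 * Real.sin ((2 * k + 1) * θ)
      = 1 - Real.cos (2 * K * θ) := by
  induction K with
  | zero => simp
  | succ K ih =>
    rw [Finset.sum_range_succ, mul_add, ih]
    have h1 : (2 * ((K + 1 : ℕ) : ℝ) * θ) = (2 * K + 1) * θ + θ := by push_cast; ring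
    have h2 : (2 * (K : ℝ) * θ) = (2 * K + 1) * θ - θ := by ring
    rw [h1, h2, Real.cos_add, Real.cos_sub]
    ring

lemma sum_two_div_odd (K : ℕ) :
    ∑ k ∈ Finset.range K, 2 / (2 * (k : ℝ) + 1) = 2 * (harmonic (2 * K) : ℝ) - harmonic K := by
  induction K with
  | zero => simp
  | succ K ih =>
    rw [Finset.sum_range_succ, ih, show 2 * (K + 1) = 2 * K + 1 + 1 by ring, harmonic_succ,
      harmonic_succ, harmonic_succ]
    push_cast
    field_simp
    ring

lemma integral_sum_sin_odd (K : ℕ) :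
    ∫ θ in (0 : ℝ)..(Real.pi / 2), ∑ k ∈ Finset.range K, 2 * Real.sin ((2 * k + 1) * θ)
      = 2 * (harmonic (2 * K) : ℝ) - harmonic K := by
  rw [intervalIntegral.integral_finsetSum
    fun k _ => (by fun_prop : Continuous _).intervalIntegrable _ _, ← sum_two_div_odd]
  refine Finset.sum_congr rfl fun k _ => ?_
  have hk : (2 * (k : ℝ) + 1) ≠ 0 := by positivity
  have hcos : Real.cos ((2 * k + 1) * (Real.pi / 2)) = 0 :=
    Real.cos_eq_zero_iff.2 ⟨k, by push_cast; ring⟩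
  rw [intervalIntegral.integral_const_mul,
    intervalIntegral.integral_comp_mul_left (fun x => Real.sin x) hk, integral_sin, hcos]
  simp
  ring

lemma tendsto_two_mul_harmonic_sub :
    Tendsto (fun K : ℕ => 2 * (harmonic (2 * K) : ℝ) - harmonic K - Real.log K) atTop
      (𝓝 (Real.eulerMascheroniConstant + 2 * Real.log 2)) := by
  have h1 := Real.tendsto_harmonic_sub_log
  have h2 := h1.comp (tendsto_id.const_mul_atTop' (zero_lt_two : (0 : ℕ) < 2))
  have h := ((h2.const_mul 2).sub h1).add_const (2 * Real.log 2)
  rw [show 2 * Real.eulerMascheroniConstant - Real.eulerMascheroniConstant + 2 * Real.log 2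
    = Real.eulerMascheroniConstant + 2 * Real.log 2 by ring] at h
  refine h.congr' ?_
  filter_upwards [eventually_ne_atTop 0] with K hK
  have hK' : (K : ℝ) ≠ 0 := Nat.cast_ne_zero.2 hK
  simp only [Function.comp_apply, id, Nat.cast_mul, Nat.cast_ofNat]
  rw [Real.log_mul two_ne_zero hK']
  ring

lemma hasDerivAt_log_sinc_sub_log_cos {θ : ℝ} (h0 : 0 < θ) (h1 : θ < Real.pi / 2) :
    HasDerivAt (fun x => Real.log (Real.sinc (x / 2)) - Real.log (Real.cos (x / 2)))
      (1 / Real.sin θ - 1 / θ) θ := by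
  have hs : 0 < Real.sin (θ / 2) := Real.sin_pos_of_pos_of_lt_pi (by linarith) (by linarith)
  have hc : 0 < Real.cos (θ / 2) := Real.cos_pos_of_mem_Ioo ⟨by linarith, by linarith⟩
  have hd : HasDerivAt (fun x : ℝ => x / 2) (1 / 2) θ := (hasDerivAt_id θ).div_const 2
  have h := ((hd.sin.log hs.ne').sub (hd.log (by positivity))).sub (hd.cos.log hc.ne')
  have hval : Real.cos (θ / 2) * (1 / 2) / Real.sin (θ / 2) - 1 / 2 / (θ / 2)
      - -Real.sin (θ / 2) * (1 / 2) / Real.cos (θ / 2) = 1 / Real.sin θ - 1 / θ := by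
    have hsin : Real.sin θ = 2 * Real.sin (θ / 2) * Real.cos (θ / 2) := by
      rw [← Real.sin_two_mul]; congr 1; ring
    have hsq := Real.sin_sq_add_cos_sq (θ / 2)
    rw [hsin]
    field_simp
    linear_combination θ * hsq
  rw [hval] at h
  refine h.congr_of_eventuallyEq ?_
  filter_upwards [Ioo_mem_nhds h0 h1] with x hx
  have hsx : 0 < Real.sin (x / 2) :=
    Real.sin_pos_of_pos_of_lt_pi (by linarith [hx.1]) (by linarith [hx.1, hx.2])
  have hx0 : x / 2 ≠ 0 := by linarith [hx.1]
  simp only [Pi.sub_apply]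
  rw [Real.sinc_of_ne_zero hx0, Real.log_div hsx.ne' hx0]

lemma sinc_pos_of_mem {x : ℝ} (h0 : 0 ≤ x) (h1 : x < Real.pi) : 0 < Real.sinc x := by
  rcases h0.eq_or_lt with rfl | h0
  · simp
  · rw [Real.sinc_of_ne_zero h0.ne']
    exact div_pos (Real.sin_pos_of_pos_of_lt_pi h0 h1) h0

lemma continuousOn_log_sinc_sub_log_cos :
    ContinuousOn (fun x => Real.log (Real.sinc (x / 2)) - Real.log (Real.cos (x / 2)))
      (Set.Icc 0 (Real.pi / 2)) := by
  have hsinc := Real.continuous_sinc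
  refine ContinuousOn.sub (ContinuousOn.log (by fun_prop) fun x hx => ?_)
    (ContinuousOn.log (by fun_prop) fun x hx => ?_)
  · exact (sinc_pos_of_mem (by linarith [hx.1]) (by linarith [hx.2, Real.pi_pos])).ne'
  · exact (Real.cos_pos_of_mem_Ioo
      ⟨by linarith [hx.1, Real.pi_pos], by linarith [hx.2, Real.pi_pos]⟩).ne'

lemma intervalIntegrable_inv_sin_sub_inv :
    IntervalIntegrable (fun θ => 1 / Real.sin θ - 1 / θ) volume 0 (Real.pi / 2) := by
  have hpi : (0 : ℝ) ≤ Real.pi / 2 := by positivity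
  refine intervalIntegral.intervalIntegrable_deriv_of_nonneg
    (by rw [Set.uIcc_of_le hpi]; exact continuousOn_log_sinc_sub_log_cos) (fun x hx => ?_)
    fun x hx => ?_
  all_goals rw [min_eq_left hpi, max_eq_right hpi] at hx
  · exact hasDerivAt_log_sinc_sub_log_cos hx.1 hx.2
  · rw [sub_nonneg]
    exact one_div_le_one_div_of_le
      (Real.sin_pos_of_pos_of_lt_pi hx.1 (by linarith [hx.2, hx.1])) (Real.sin_le hx.1.le)

lemma integral_inv_sin_sub_inv :
    ∫ θ in (0 : ℝ)..(Real.pi / 2), (1 / Real.sin θ - 1 / θ)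
      = 2 * Real.log 2 - Real.log Real.pi := by
  rw [intervalIntegral.integral_eq_sub_of_hasDerivAt_of_le (by positivity)
    continuousOn_log_sinc_sub_log_cos
    (fun x hx => hasDerivAt_log_sinc_sub_log_cos hx.1 hx.2) intervalIntegrable_inv_sin_sub_inv]
  have h4 : Real.pi / 2 / 2 = Real.pi / 4 := by ring
  have hpi := Real.pi_pos
  rw [h4, Real.sinc_of_ne_zero (by positivity), Real.sin_pi_div_four, Real.cos_pi_div_four,
    Real.log_div (by positivity) (by positivity), Real.log_div (x := Real.pi) (by positivity)
    (by positivity), show (4 : ℝ) = 2 ^ 2 by norm_num, Real.log_pow]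
  simp

lemma one_sub_cos_div_eq (ω x : ℝ) :
    (1 - Real.cos (ω * x)) / x = ω * Real.sin (ω * x / 2) * Real.sinc (ω * x / 2) := by
  rcases eq_or_ne x 0 with rfl | hx
  · simp
  rcases eq_or_ne ω 0 with rfl | hω
  · simp
  rw [Real.sinc_of_ne_zero (by positivity)]
  have : Real.cos (ω * x) = 1 - 2 * Real.sin (ω * x / 2) ^ 2 := by
    rw [show ω * x = 2 * (ω * x / 2) by ring, Real.cos_two_mul, Real.cos_sq']; ring_nf
  rw [this]
  field_simp
  ring

lemma continuous_one_sub_cos_div (ω : ℝ) :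
    Continuous fun x => (1 - Real.cos (ω * x)) / x := by
  have hsinc := Real.continuous_sinc
  simp_rw [one_sub_cos_div_eq]
  fun_prop

/-- The asymptotic expansion of the entire cosine integral along multiples of `π`. -/
lemma tendsto_integral_one_sub_cos_div_sub_log :
    Tendsto (fun K : ℕ => (∫ θ in (0 : ℝ)..(Real.pi / 2), (1 - Real.cos (2 * K * θ)) / θ)
      - Real.log K) atTop (𝓝 (Real.eulerMascheroniConstant + Real.log Real.pi)) := by
  have hpi : (0 : ℝ) ≤ Real.pi / 2 := by positivity
  have hg := intervalIntegrable_inv_sin_sub_inv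
  have h := (tendsto_two_mul_harmonic_sub.sub_const (2 * Real.log 2 - Real.log Real.pi)).add
    (tendsto_intervalIntegral_cos_mul hpi hg zero_lt_two)
  rw [show Real.eulerMascheroniConstant + 2 * Real.log 2 - (2 * Real.log 2 - Real.log Real.pi) + 0
    = Real.eulerMascheroniConstant + Real.log Real.pi by ring] at h
  refine h.congr fun K => ?_
  have hcos : IntervalIntegrable (fun θ => Real.cos (2 * K * θ) * (1 / Real.sin θ - 1 / θ))
      volume 0 (Real.pi / 2) := hg.continuousOn_mul (by fun_prop)
  rw [← integral_sum_sin_odd, ← integral_inv_sin_sub_inv]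
  have key : ∫ θ in (0 : ℝ)..(Real.pi / 2), (1 - Real.cos (2 * K * θ)) / θ
      = ∫ θ in (0 : ℝ)..(Real.pi / 2), ((∑ k ∈ Finset.range K, 2 * Real.sin ((2 * k + 1) * θ))
        - (1 / Real.sin θ - 1 / θ) + Real.cos (2 * K * θ) * (1 / Real.sin θ - 1 / θ)) := by
    refine intervalIntegral.integral_congr_Ioo_of_le hpi fun θ hθ => ?_
    have hs : 0 < Real.sin θ :=
      Real.sin_pos_of_pos_of_lt_pi hθ.1 (by linarith [hθ.2, hθ.1])
    have hθ0 : θ ≠ 0 := hθ.1.ne'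
    have := sin_mul_sum_sin_odd θ K
    rw [mul_comm, ← eq_div_iff hs.ne'] at this
    rw [this]
    field_simp
    ring
  rw [key, intervalIntegral.integral_add _ hcos, intervalIntegral.integral_sub _ hg]
  · ring
  · exact (by fun_prop : Continuous _).intervalIntegrable _ _
  · exact ((by fun_prop : Continuous _).intervalIntegrable _ _).sub hg

end CosineIntegral

section LogGammaSine

lemma continuous_log_smul {E : Type*} [NormedAddCommGroup E] [NormedSpace ℝ E] {f : ℝ → E}
    (hf : Continuous f) {C : ℝ} (hC : ∀ x, ‖f x‖ ≤ C * |x|) :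
    Continuous fun x => Real.log x • f x := by
  refine continuous_iff_continuousAt.2 fun x => ?_
  rcases eq_or_ne x 0 with rfl | hx
  · have hlim : Tendsto (fun x : ℝ => C * |x * Real.log x|) (𝓝 0) (𝓝 0) := by
      simpa using (Real.continuous_mul_log.abs.const_mul C).tendsto 0
    rw [ContinuousAt, Real.log_zero, zero_smul]
    refine squeeze_zero_norm (fun x => ?_) hlim
    rw [norm_smul, abs_mul, Real.norm_eq_abs]
    nlinarith [hC x, abs_nonneg (Real.log x)]
  · exact (Real.continuousAt_log hx).smul hf.continuousAt

lemma intervalIntegrable_log_mul_sin (ω a b : ℝ) :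
    IntervalIntegrable (fun y => Real.log y * Real.sin (ω * y)) volume a b :=
  intervalIntegral.intervalIntegrable_log'.mul_continuousOn (by fun_prop)

lemma integral_log_mul_sin {n : ℕ} (hn : n ≠ 0) (M : ℕ) :
    ∫ y in (0 : ℝ)..M, Real.log y * Real.sin (2 * Real.pi * n * y)
      = -(∫ θ in (0 : ℝ)..(Real.pi / 2), (1 - Real.cos (2 * (2 * n * M : ℕ) * θ)) / θ)
        / (2 * Real.pi * n) := by
  have hn' : (0 : ℝ) < n := by positivity
  set ω : ℝ := 2 * Real.pi * n with hω
  have hω0 : 0 < ω := by positivity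
  have hcont : Continuous fun y => Real.log y • ((1 - Real.cos (ω * y)) / ω) := by
    refine continuous_log_smul (C := 1) (by fun_prop) fun y => ?_
    have h := one_sub_cos_div_eq ω y
    rcases eq_or_ne y 0 with rfl | hy
    · simp
    rw [div_eq_iff hy] at h
    rw [h, Real.norm_eq_abs, abs_div, abs_mul, abs_mul, abs_mul, abs_of_pos hω0,
      div_le_iff₀ hω0]
    have h1 := Real.abs_sin_le_one (ω * y / 2)
    have h2 := Real.abs_sinc_le_one (ω * y / 2)
    have h3 := mul_le_one₀ h1 (abs_nonneg _) h2
    nlinarith [mul_nonneg hω0.le (abs_nonneg y)]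
  have hderiv : ∀ y ∈ Set.Ioo (0 : ℝ) M,
      HasDerivAt (fun y => Real.log y • ((1 - Real.cos (ω * y)) / ω))
        ((1 - Real.cos (ω * y)) / y / ω + Real.log y * Real.sin (ω * y)) y := by
    intro y hy
    have hlin : HasDerivAt (fun y => ω * y) ω y := by
      simpa using (hasDerivAt_id y).const_mul ω
    have h := (Real.hasDerivAt_log hy.1.ne').mul ((hlin.cos.const_sub 1).div_const ω)
    refine h.congr_deriv ?_
    field_simp
  have hint := intervalIntegrable_log_mul_sin ω 0 M
  have hint' : IntervalIntegrable (fun y => (1 - Real.cos (ω * y)) / y / ω) volume 0 M :=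
    ((continuous_one_sub_cos_div ω).div_const ω).intervalIntegrable _ _
  have h := intervalIntegral.integral_eq_sub_of_hasDerivAt_of_le M.cast_nonneg
    hcont.continuousOn hderiv (hint'.add hint)
  have hcos : Real.cos (ω * M) = 1 := by
    rw [hω, show 2 * Real.pi * n * M = ((n * M : ℕ) : ℝ) * (2 * Real.pi) by push_cast; ring]
    exact Real.cos_nat_mul_two_pi _
  rw [intervalIntegral.integral_add hint' hint, hcos, intervalIntegral.integral_div] at h
  have hscale := intervalIntegral.mul_integral_comp_mul_right
    (f := fun y => (1 - Real.cos (ω * y)) / y) (a := 0) (b := Real.pi / 2) (2 * M / Real.pi)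
  rw [zero_mul, show Real.pi / 2 * (2 * M / Real.pi) = M by field_simp,
    ← intervalIntegral.integral_const_mul] at hscale
  have hfun : ∀ θ : ℝ, 2 * M / Real.pi * ((1 - Real.cos (ω * (θ * (2 * M / Real.pi))))
      / (θ * (2 * M / Real.pi))) = (1 - Real.cos (2 * (2 * n * M : ℕ) * θ)) / θ := by
    intro θ
    rcases eq_or_ne M 0 with rfl | hM
    · simp
    rw [show ω * (θ * (2 * M / Real.pi)) = 2 * (2 * n * M : ℕ) * θ by
      rw [hω]; push_cast; field_simp]
    field_simp
  simp only [hfun] at hscale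
  rw [← hscale] at h
  simp only [sub_self, zero_div, smul_zero, mul_zero, Real.cos_zero] at h
  rw [eq_div_iff hω0.ne']
  field_simp at h
  linarith

lemma sum_integral_log_add_mul_sin (n M : ℕ) :
    ∑ m ∈ Finset.range M, ∫ x in (0 : ℝ)..1, Real.log (x + m) * Real.sin (2 * Real.pi * n * x)
      = ∫ y in (0 : ℝ)..M, Real.log y * Real.sin (2 * Real.pi * n * y) := by
  have h := intervalIntegral.sum_integral_adjacent_intervals (a := fun m : ℕ => (m : ℝ)) (n := M)
    fun m _ => intervalIntegrable_log_mul_sin (2 * Real.pi * n) m (m + 1 : ℕ)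
  rw [Nat.cast_zero] at h
  rw [← h]
  refine Finset.sum_congr rfl fun m _ => ?_
  have hshift := intervalIntegral.integral_comp_add_right (a := 0) (b := 1)
    (fun y => Real.log y * Real.sin (2 * Real.pi * n * y)) (m : ℝ)
  rw [zero_add] at hshift
  rw [Nat.cast_add, Nat.cast_one, add_comm (m : ℝ) 1, ← hshift]
  refine intervalIntegral.integral_congr fun x _ => ?_
  rw [show 2 * Real.pi * n * (x + m) = 2 * Real.pi * n * x + ((n * m : ℕ) : ℝ) * (2 * Real.pi) by
    push_cast; ring, Real.sin_add_nat_mul_two_pi]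

lemma log_Gamma_add_one {x : ℝ} (hx : 0 ≤ x) :
    Real.log (Real.Gamma x) = Real.log (Real.Gamma (x + 1)) - Real.log x := by
  rcases hx.eq_or_lt with rfl | hx
  · simp
  · rw [Real.Gamma_add_one hx.ne', Real.log_mul hx.ne' (Real.Gamma_pos_of_pos hx).ne']
    ring

lemma log_Gamma_add_nat {x : ℝ} (hx : 0 < x) (M : ℕ) :
    Real.log (Real.Gamma (x + M))
      = Real.log (Real.Gamma x) + ∑ m ∈ Finset.range M, Real.log (x + m) :=
  Real.BohrMollerup.f_add_nat_eq (f := fun x => Real.log (Real.Gamma x))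
    (fun hy => by rw [log_Gamma_add_one hy.le]; ring) hx M

lemma continuousOn_log_Gamma : ContinuousOn (fun x => Real.log (Real.Gamma x)) (Set.Ioi 0) := by
  refine fun x hx => ContinuousAt.continuousWithinAt ?_
  refine (Real.differentiableAt_Gamma fun m => ?_).continuousAt.log
    (Real.Gamma_pos_of_pos hx).ne'
  exact (neg_lt_iff_pos_add.mpr (add_pos_of_pos_of_nonneg hx m.cast_nonneg)).ne'

lemma intervalIntegrable_log_Gamma :
    IntervalIntegrable (fun x => Real.log (Real.Gamma x)) volume 0 1 := by
  have h : IntervalIntegrable (fun x => Real.log (Real.Gamma (x + 1)) - Real.log x)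
      volume 0 1 := by
    refine (ContinuousOn.intervalIntegrable ?_).sub intervalIntegral.intervalIntegrable_log'
    refine continuousOn_log_Gamma.comp (by fun_prop) fun x hx => ?_
    rw [Set.uIcc_of_le zero_le_one] at hx
    exact Set.mem_Ioi.2 (by linarith [hx.1])
  refine h.congr fun x hx => ?_
  rw [Set.uIoc_of_le zero_le_one] at hx
  exact (log_Gamma_add_one hx.1.le).symm

lemma abs_log_Gamma_add_sub_le {x : ℝ} (h0 : 0 < x) (h1 : x ≤ 1) {M : ℕ} (hM : 2 ≤ M) :
    |Real.log (Real.Gamma (x + M)) - (Real.log (Real.Gamma M) + x * Real.log M)|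
      ≤ Real.log M - Real.log (M - 1) := by
  have hfeq : ∀ {y : ℝ}, 0 < y →
      (Real.log ∘ Real.Gamma) (y + 1) = (Real.log ∘ Real.Gamma) y + Real.log y := fun hy => by
    simp only [Function.comp_apply]
    rw [log_Gamma_add_one hy.le]; ring
  have hle := Real.BohrMollerup.f_add_nat_le Real.convexOn_log_Gamma hfeq (by omega : M ≠ 0) h0 h1
  have hge := Real.BohrMollerup.f_add_nat_ge Real.convexOn_log_Gamma hfeq hM h0
  simp only [Function.comp_apply, add_comm (M : ℝ) x] at hle hge
  have hM' : (2 : ℝ) ≤ M := by exact_mod_cast hM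
  have hlog : Real.log (M - 1) ≤ Real.log M := Real.log_le_log (by linarith) (by linarith)
  rw [abs_le]
  constructor <;> nlinarith

lemma integral_sin_two_pi_mul (n : ℕ) :
    ∫ x in (0 : ℝ)..1, Real.sin (2 * Real.pi * n * x) = 0 := by
  rcases eq_or_ne n 0 with rfl | hn
  · simp
  have h0 : 2 * Real.pi * n ≠ 0 := by positivity
  rw [intervalIntegral.integral_comp_mul_left (fun x => Real.sin x) h0, integral_sin, mul_one,
    mul_comm, Real.cos_nat_mul_two_pi]
  simp

lemma integral_mul_sin_two_pi_mul {n : ℕ} (hn : n ≠ 0) :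
    ∫ x in (0 : ℝ)..1, x * Real.sin (2 * Real.pi * n * x) = -1 / (2 * Real.pi * n) := by
  have h0 : 2 * Real.pi * n ≠ 0 := by positivity
  have hderiv : ∀ x ∈ Set.uIcc (0 : ℝ) 1, HasDerivAt
      (fun x => Real.sin (2 * Real.pi * n * x) / (2 * Real.pi * n) ^ 2
        - x * Real.cos (2 * Real.pi * n * x) / (2 * Real.pi * n))
      (x * Real.sin (2 * Real.pi * n * x)) x := by
    intro x _
    have hlin : HasDerivAt (fun x => 2 * Real.pi * n * x) (2 * Real.pi * n) x := by
      simpa using (hasDerivAt_id x).const_mul (2 * Real.pi * n)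
    have h := (hlin.sin.div_const ((2 * Real.pi * n) ^ 2)).sub
      (((hasDerivAt_id x).mul hlin.cos).div_const (2 * Real.pi * n))
    refine h.congr_deriv ?_
    simp only [id]
    field_simp
    ring
  rw [intervalIntegral.integral_eq_sub_of_hasDerivAt hderiv
    ((by fun_prop : Continuous _).intervalIntegrable _ _), mul_one,
    show 2 * Real.pi * n = (n : ℝ) * (2 * Real.pi) by ring, Real.cos_nat_mul_two_pi,
    show (n : ℝ) * (2 * Real.pi) = ((2 * n : ℕ) : ℝ) * Real.pi by push_cast; ring,
    Real.sin_nat_mul_pi]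
  simp
  ring

lemma tendsto_integral_log_Gamma_add_mul_sin {n : ℕ} (hn : n ≠ 0) :
    Tendsto (fun M : ℕ => (∫ x in (0 : ℝ)..1, Real.log (Real.Gamma (x + M))
        * Real.sin (2 * Real.pi * n * x)) + Real.log M / (2 * Real.pi * n)) atTop (𝓝 0) := by
  have hbound : Tendsto (fun M : ℕ => Real.log M - Real.log (M - 1)) atTop (𝓝 0) := by
    have h := Real.tendsto_log_nat_add_one_sub_log
    rw [← tendsto_add_atTop_iff_nat 1]
    refine h.congr fun M => ?_
    push_cast
    simp
  refine squeeze_zero_norm' ?_ hbound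
  filter_upwards [eventually_ge_atTop 2] with M hM
  have hMpos : (0 : ℝ) < M := by positivity
  have hcont : IntervalIntegrable (fun x => Real.log (Real.Gamma (x + M))
      * Real.sin (2 * Real.pi * n * x)) volume 0 1 := by
    refine ContinuousOn.intervalIntegrable (ContinuousOn.mul
      (continuousOn_log_Gamma.comp (by fun_prop) fun x hx => ?_) (by fun_prop))
    rw [Set.uIcc_of_le zero_le_one] at hx
    exact Set.mem_Ioi.2 (by linarith [hx.1])
  have hsub : (∫ x in (0 : ℝ)..1, Real.log (Real.Gamma (x + M)) * Real.sin (2 * Real.pi * n * x))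
      + Real.log M / (2 * Real.pi * n)
      = ∫ x in (0 : ℝ)..1, (Real.log (Real.Gamma (x + M))
        - (Real.log (Real.Gamma M) + x * Real.log M)) * Real.sin (2 * Real.pi * n * x) := by
    have hs : IntervalIntegrable (fun x => Real.log (Real.Gamma M)
        * Real.sin (2 * Real.pi * n * x)) volume 0 1 :=
      (by fun_prop : Continuous _).intervalIntegrable _ _
    have hxs : IntervalIntegrable (fun x => Real.log M * (x * Real.sin (2 * Real.pi * n * x)))
        volume 0 1 :=
      (by fun_prop : Continuous _).intervalIntegrable _ _
    have hexp : ∀ x, (Real.log (Real.Gamma (x + M))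
        - (Real.log (Real.Gamma M) + x * Real.log M)) * Real.sin (2 * Real.pi * n * x)
        = Real.log (Real.Gamma (x + M)) * Real.sin (2 * Real.pi * n * x)
          - Real.log (Real.Gamma M) * Real.sin (2 * Real.pi * n * x)
          - Real.log M * (x * Real.sin (2 * Real.pi * n * x)) := fun x => by ring
    simp only [hexp]
    rw [intervalIntegral.integral_sub (hcont.sub hs) hxs, intervalIntegral.integral_sub hcont hs,
      intervalIntegral.integral_const_mul, intervalIntegral.integral_const_mul,
      integral_sin_two_pi_mul, integral_mul_sin_two_pi_mul hn]
    ring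
  rw [hsub]
  have h := intervalIntegral.norm_integral_le_of_norm_le_const (a := 0) (b := 1)
    (f := fun x => (Real.log (Real.Gamma (x + M))
        - (Real.log (Real.Gamma M) + x * Real.log M)) * Real.sin (2 * Real.pi * n * x))
    (C := Real.log M - Real.log (M - 1)) fun x hx => ?_
  · simpa using h
  · rw [Set.uIoc_of_le zero_le_one] at hx
    rw [norm_mul]
    have h1 := abs_log_Gamma_add_sub_le hx.1 hx.2 hM
    have h2 := Real.abs_sin_le_one (2 * Real.pi * n * x)
    exact (mul_le_of_le_one_right (norm_nonneg _) h2).trans h1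

/-- The sine Fourier coefficients of `log Γ` on `(0, 1)`. -/
lemma integral_log_Gamma_mul_sin {n : ℕ} (hn : n ≠ 0) :
    ∫ x in (0 : ℝ)..1, Real.log (Real.Gamma x) * Real.sin (2 * Real.pi * n * x)
      = (Real.eulerMascheroniConstant + Real.log (2 * Real.pi * n)) / (2 * Real.pi * n) := by
  have hsplit : ∀ M : ℕ, ∫ x in (0 : ℝ)..1,
      Real.log (Real.Gamma x) * Real.sin (2 * Real.pi * n * x)
      = (∫ x in (0 : ℝ)..1, Real.log (Real.Gamma (x + M)) * Real.sin (2 * Real.pi * n * x))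
        - ∫ y in (0 : ℝ)..M, Real.log y * Real.sin (2 * Real.pi * n * y) := by
    intro M
    have hi : ∀ m ∈ Finset.range M, IntervalIntegrable
        (fun x => Real.log (x + m) * Real.sin (2 * Real.pi * n * x)) volume 0 1 := by
      intro m _
      refine IntervalIntegrable.mul_continuousOn ?_ (by fun_prop)
      simpa using
        (intervalIntegral.intervalIntegrable_log' (a := 0 + m) (b := 1 + m)).comp_add_right (m : ℝ)
    rw [← sum_integral_log_add_mul_sin, ← intervalIntegral.integral_finsetSum hi, eq_sub_iff_add_eq,
      ← intervalIntegral.integral_add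
        (intervalIntegrable_log_Gamma.mul_continuousOn (by fun_prop)) (by
          simpa only [Finset.sum_fn] using IntervalIntegrable.sum _ hi)]
    refine intervalIntegral.integral_congr_Ioo_of_le zero_le_one fun x hx => ?_
    rw [log_Gamma_add_nat hx.1, add_mul, Finset.sum_mul]
  have hK : Tendsto (fun M : ℕ => 2 * n * M) atTop atTop :=
    tendsto_id.const_mul_atTop' (by positivity)
  have h := (tendsto_integral_log_Gamma_add_mul_sin hn).add
    (((tendsto_integral_one_sub_cos_div_sub_log.comp hK).add_const
      (Real.log (2 * n))).div_const (2 * Real.pi * n))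
  refine (tendsto_nhds_unique (tendsto_const_nhds.congr' ?_) h).trans ?_
  · filter_upwards [eventually_ne_atTop 0] with M hM
    rw [hsplit M, integral_log_mul_sin hn]
    simp only [Function.comp_apply]
    rw [show ((2 * n * M : ℕ) : ℝ) = 2 * n * M by push_cast; ring,
      Real.log_mul (by positivity) (by positivity)]
    ring
  · rw [show 2 * Real.pi * n = Real.pi * (2 * n) by ring,
      Real.log_mul (x := Real.pi) (y := 2 * n) (by positivity) (by positivity)]
    ring

end LogGammaSine

section FourierCoefficients

lemma intervalIntegrable_complex_ofReal {f : ℝ → ℝ} {a b : ℝ}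
    (hf : IntervalIntegrable f volume a b) :
    IntervalIntegrable (fun x => (f x : ℂ)) volume a b :=
  ⟨hf.1.ofReal, hf.2.ofReal⟩

/-- The part of `log Γ` on `(0, 1)` that is odd about `1 / 2`, corrected by a linear function and
scaled so that its Fourier series is `∑ log n * sin (2πnu) / n`. -/
noncomputable def oddLogGamma (u : ℝ) : ℝ :=
  Real.pi * ((Real.log (Real.Gamma u) - Real.log (Real.Gamma (1 - u))) / 2
    + (u - 1 / 2) * (Real.eulerMascheroniConstant + Real.log (2 * Real.pi)))

lemma oddLogGamma_one_sub (u : ℝ) : oddLogGamma (1 - u) = -oddLogGamma u := by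
  simp only [oddLogGamma, sub_sub_cancel]
  ring

lemma intervalIntegrable_log_Gamma_one_sub :
    IntervalIntegrable (fun x => Real.log (Real.Gamma (1 - x))) volume 0 1 := by
  simpa using (intervalIntegrable_log_Gamma.comp_sub_left 1).symm

lemma intervalIntegrable_oddLogGamma : IntervalIntegrable oddLogGamma volume 0 1 := by
  refine IntervalIntegrable.const_mul (((intervalIntegrable_log_Gamma.sub
    intervalIntegrable_log_Gamma_one_sub).div_const 2).add ?_) _
  exact (by fun_prop : Continuous _).intervalIntegrable _ _

lemma integral_oddLogGamma_mul_cos (n : ℤ) :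
    ∫ x in (0 : ℝ)..1, oddLogGamma x * Real.cos (2 * Real.pi * n * x) = 0 := by
  have h := intervalIntegral.integral_comp_sub_left (a := 0) (b := 1)
    (fun x => oddLogGamma x * Real.cos (2 * Real.pi * n * x)) 1
  have hcos : ∀ x : ℝ, Real.cos (2 * Real.pi * n * (1 - x)) = Real.cos (2 * Real.pi * n * x) := by
    intro x
    rw [show 2 * Real.pi * n * (1 - x) = n * (2 * Real.pi) - 2 * Real.pi * n * x by ring,
      Real.cos_int_mul_two_pi_sub]
  simp only [oddLogGamma_one_sub, hcos, neg_mul, intervalIntegral.integral_neg, sub_self,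
    sub_zero] at h
  linarith

lemma integral_oddLogGamma_mul_sin_nat (n : ℕ) :
    ∫ x in (0 : ℝ)..1, oddLogGamma x * Real.sin (2 * Real.pi * n * x)
      = Real.log n / n / 2 := by
  rcases eq_or_ne n 0 with rfl | hn
  · simp
  have h1 := integral_log_Gamma_mul_sin hn
  have h2 : ∫ x in (0 : ℝ)..1, Real.log (Real.Gamma (1 - x)) * Real.sin (2 * Real.pi * n * x)
      = -∫ x in (0 : ℝ)..1, Real.log (Real.Gamma x) * Real.sin (2 * Real.pi * n * x) := by
    have h := intervalIntegral.integral_comp_sub_left (a := 0) (b := 1)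
      (fun x => Real.log (Real.Gamma x) * Real.sin (2 * Real.pi * n * x)) 1
    have hsin : ∀ x : ℝ, Real.sin (2 * Real.pi * n * (1 - x))
        = -Real.sin (2 * Real.pi * n * x) := by
      intro x
      rw [show 2 * Real.pi * n * (1 - x) = n * (2 * Real.pi) - 2 * Real.pi * n * x by ring,
        Real.sin_nat_mul_two_pi_sub]
    simp only [hsin, mul_neg, intervalIntegral.integral_neg, sub_self, sub_zero] at h
    linarith
  have hs : ContinuousOn (fun x => Real.sin (2 * Real.pi * n * x)) (Set.uIcc 0 1) := by fun_prop
  have i1 := (intervalIntegrable_log_Gamma.mul_continuousOn hs).const_mul (Real.pi / 2)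
  have i2 := (intervalIntegrable_log_Gamma_one_sub.mul_continuousOn hs).const_mul (Real.pi / 2)
  set κ := Real.eulerMascheroniConstant + Real.log (2 * Real.pi) with hκ
  have i3 : IntervalIntegrable (fun x => Real.pi * κ * (x * Real.sin (2 * Real.pi * n * x)))
      volume 0 1 := (by fun_prop : Continuous _).intervalIntegrable _ _
  have i4 : IntervalIntegrable (fun x => Real.pi * κ / 2 * Real.sin (2 * Real.pi * n * x))
      volume 0 1 := (by fun_prop : Continuous _).intervalIntegrable _ _
  have hexp : ∀ x, oddLogGamma x * Real.sin (2 * Real.pi * n * x)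
      = Real.pi / 2 * (Real.log (Real.Gamma x) * Real.sin (2 * Real.pi * n * x))
        - Real.pi / 2 * (Real.log (Real.Gamma (1 - x)) * Real.sin (2 * Real.pi * n * x))
        + Real.pi * κ * (x * Real.sin (2 * Real.pi * n * x))
        - Real.pi * κ / 2 * Real.sin (2 * Real.pi * n * x) := by
    intro x
    rw [oddLogGamma]
    ring
  simp only [hexp]
  rw [intervalIntegral.integral_sub ((i1.sub i2).add i3) i4,
    intervalIntegral.integral_add (i1.sub i2) i3, intervalIntegral.integral_sub i1 i2]
  simp only [intervalIntegral.integral_const_mul]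
  rw [h2, h1, integral_sin_two_pi_mul, integral_mul_sin_two_pi_mul hn,
    Real.log_mul (x := 2 * Real.pi) (by positivity) (by positivity), hκ]
  field_simp
  ring

lemma integral_oddLogGamma_mul_sin (n : ℤ) :
    ∫ x in (0 : ℝ)..1, oddLogGamma x * Real.sin (2 * Real.pi * n * x)
      = Real.log n / n / 2 := by
  rcases Int.eq_nat_or_neg n with ⟨k, rfl | rfl⟩
  · exact_mod_cast integral_oddLogGamma_mul_sin_nat k
  · have h := integral_oddLogGamma_mul_sin_nat k
    simp only [Int.cast_neg, Int.cast_natCast, mul_neg, neg_mul, Real.sin_neg,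
      intervalIntegral.integral_neg, Real.log_neg_eq_log, div_neg, neg_div, h]

lemma integral_fourier_smul_oddLogGamma (n : ℤ) :
    ∫ x in (0 : ℝ)..1, fourier (-n) (x : AddCircle (1 : ℝ)) • (oddLogGamma x : ℂ)
      = -(Complex.I / 2) * (Real.log n / n : ℝ) := by
  have hexp : ∀ x : ℝ, fourier (-n) (x : AddCircle (1 : ℝ)) • (oddLogGamma x : ℂ)
      = ((oddLogGamma x * Real.cos (2 * Real.pi * n * x) : ℝ) : ℂ)
        - Complex.I * ((oddLogGamma x * Real.sin (2 * Real.pi * n * x) : ℝ) : ℂ) := by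
    intro x
    rw [fourier_coe_apply, show 2 * (Real.pi : ℂ) * Complex.I * ((-n : ℤ) : ℂ) * x / (1 : ℝ)
      = ((-(2 * Real.pi * n * x) : ℝ) : ℂ) * Complex.I by push_cast; ring,
      Complex.exp_mul_I, ← Complex.ofReal_cos, ← Complex.ofReal_sin, Real.cos_neg, Real.sin_neg,
      smul_eq_mul]
    push_cast
    ring
  simp only [hexp]
  have ic : IntervalIntegrable (fun x => oddLogGamma x * Real.cos (2 * Real.pi * n * x))
      volume 0 1 := intervalIntegrable_oddLogGamma.mul_continuousOn (by fun_prop)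
  have is : IntervalIntegrable (fun x => oddLogGamma x * Real.sin (2 * Real.pi * n * x))
      volume 0 1 := intervalIntegrable_oddLogGamma.mul_continuousOn (by fun_prop)
  rw [intervalIntegral.integral_sub (intervalIntegrable_complex_ofReal ic)
      ((intervalIntegrable_complex_ofReal is).const_mul _),
    intervalIntegral.integral_const_mul, intervalIntegral.integral_ofReal,
    intervalIntegral.integral_ofReal, integral_oddLogGamma_mul_cos, integral_oddLogGamma_mul_sin]
  push_cast
  ring

lemma norm_one_sub_fourier_one_le (x : ℝ) :
    ‖1 - fourier 1 (x : AddCircle (1 : ℝ))‖ ≤ 2 * Real.pi * |x| := by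
  rw [fourier_coe_apply, norm_sub_rev]
  have h := Real.norm_exp_I_mul_ofReal_sub_one_le (x := 2 * Real.pi * x)
  rw [Real.norm_eq_abs, abs_mul, abs_of_pos Real.two_pi_pos] at h
  rwa [show 2 * (Real.pi : ℂ) * Complex.I * ((1 : ℤ) : ℂ) * x / (1 : ℝ)
    = Complex.I * ((2 * Real.pi * x : ℝ) : ℂ) by push_cast; ring]

lemma continuous_fourier_one_coe :
    Continuous fun x : ℝ => fourier 1 (x : AddCircle (1 : ℝ)) :=
  (map_continuous _).comp (AddCircle.continuous_mk' 1)

lemma fourier_one_one_sub (x : ℝ) :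
    fourier 1 ((1 - x : ℝ) : AddCircle (1 : ℝ)) = fourier 1 ((-x : ℝ) : AddCircle (1 : ℝ)) := by
  congr 1
  rw [sub_eq_add_neg, add_comm, AddCircle.coe_add_period]

lemma continuousOn_one_sub_fourier_mul_oddLogGamma :
    ContinuousOn (fun x : ℝ => (1 - fourier 1 (x : AddCircle (1 : ℝ))) * (oddLogGamma x : ℂ))
      (Set.Icc 0 1) := by
  have he := continuous_fourier_one_coe
  have hl : Continuous fun x : ℝ => Real.log x • (1 - fourier 1 (x : AddCircle (1 : ℝ))) :=
    continuous_log_smul (by fun_prop) norm_one_sub_fourier_one_le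
  have hr : Continuous fun x : ℝ => Real.log x •
      (1 - fourier 1 ((1 - x : ℝ) : AddCircle (1 : ℝ))) := by
    refine continuous_log_smul (C := 2 * Real.pi)
      (continuous_const.sub (he.comp (by fun_prop : Continuous fun x : ℝ => 1 - x))) fun x => ?_
    rw [fourier_one_one_sub]
    simpa using norm_one_sub_fourier_one_le (-x)
  have hr' := hr.comp (by fun_prop : Continuous fun x : ℝ => 1 - x)
  have hreg : ContinuousOn (fun x => Real.pi *
      ((Real.log (Real.Gamma (x + 1)) - Real.log (Real.Gamma (1 - x + 1))) / 2
        + (x - 1 / 2) * (Real.eulerMascheroniConstant + Real.log (2 * Real.pi))))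
      (Set.Icc 0 1) := by
    have h1 : ContinuousOn (fun x => Real.log (Real.Gamma (x + 1))) (Set.Icc 0 1) :=
      continuousOn_log_Gamma.comp (by fun_prop) fun x hx => Set.mem_Ioi.2 (by linarith [hx.1])
    have h2 : ContinuousOn (fun x => Real.log (Real.Gamma (1 - x + 1))) (Set.Icc 0 1) :=
      continuousOn_log_Gamma.comp (f := fun x => 1 - x + 1) (by fun_prop)
        fun x hx => Set.mem_Ioi.2 (by linarith [hx.2])
    fun_prop
  have hreg' := Complex.continuous_ofReal.comp_continuousOn hreg
  refine ((((continuousOn_const (c := (1 : ℂ))).sub he.continuousOn).mul hreg').sub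
    ((hl.sub hr').continuousOn.const_smul (Real.pi / 2))).congr fun x hx => ?_
  simp only [oddLogGamma, Function.comp_apply, Pi.smul_apply, Pi.sub_apply, Pi.mul_apply,
    log_Gamma_add_one hx.1, log_Gamma_add_one (sub_nonneg.2 hx.2), sub_sub_cancel,
    Complex.real_smul]
  push_cast
  ring

lemma fourierCoeff_one_sub_fourier_mul_oddLogGamma (n : ℤ) :
    fourierCoeff (AddCircle.liftIco 1 0
      fun x : ℝ => (1 - fourier 1 (x : AddCircle (1 : ℝ))) * (oddLogGamma x : ℂ)) n
      = -(Complex.I / 2) * ((Real.log n / n : ℝ) - (Real.log (n - 1 : ℤ) / (n - 1 : ℤ) : ℝ)) := by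
  have hint : ∀ m : ℤ, IntervalIntegrable
      (fun x : ℝ => fourier m (x : AddCircle (1 : ℝ)) • (oddLogGamma x : ℂ)) volume 0 1 :=
    fun m => (intervalIntegrable_complex_ofReal intervalIntegrable_oddLogGamma).continuousOn_mul
      ((map_continuous _).comp (AddCircle.continuous_mk' 1)).continuousOn
  have hsplit : ∀ x : ℝ, fourier (-n) (x : AddCircle (1 : ℝ)) •
      ((1 - fourier 1 (x : AddCircle (1 : ℝ))) * (oddLogGamma x : ℂ))
      = fourier (-n) (x : AddCircle (1 : ℝ)) • (oddLogGamma x : ℂ)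
        - fourier (-(n - 1)) (x : AddCircle (1 : ℝ)) • (oddLogGamma x : ℂ) := by
    intro x
    rw [show -(n - 1) = -n + 1 by ring, fourier_add]
    simp only [smul_eq_mul]
    ring
  rw [fourierCoeff_eq_intervalIntegral _ n 0]
  rw [intervalIntegral.integral_congr_Ioo_of_le (g := fun x : ℝ =>
    fourier (-n) (x : AddCircle (1 : ℝ)) •
      ((1 - fourier 1 (x : AddCircle (1 : ℝ))) * (oddLogGamma x : ℂ))) (by norm_num) fun x hx => by
    rw [AddCircle.liftIco_coe_apply (Set.Ioo_subset_Ico_self hx)]]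
  simp only [hsplit, zero_add, div_one, one_smul]
  rw [intervalIntegral.integral_sub (hint _) (hint _), integral_fourier_smul_oddLogGamma,
    integral_fourier_smul_oddLogGamma]
  ring

end FourierCoefficients

section Summation

lemma tendsto_log_div_natCast :
    Tendsto (fun n : ℕ => Real.log n / n) atTop (𝓝 0) := by
  simpa [Function.comp_def] using
    (Real.isLittleO_log_id_atTop.tendsto_div_nhds_zero).comp tendsto_natCast_atTop_atTop

lemma summable_log_div_sub_log_div :
    Summable fun n : ℕ => Real.log (n + 1 : ℕ) / (n + 1 : ℕ) - Real.log n / n := by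
  rw [← summable_nat_add_iff 3, ← summable_neg_iff]
  have hexp : Real.exp 1 ≤ 3 := by linarith [Real.exp_one_lt_d9]
  refine summable_of_sum_range_le (c := Real.log 3 / 3) (fun n => ?_) fun n => ?_
  · have hn : (0 : ℝ) ≤ n := n.cast_nonneg
    have h := Real.log_div_self_antitoneOn (a := ((n + 3 : ℕ) : ℝ)) (b := ((n + 3 + 1 : ℕ) : ℝ))
      (Set.mem_ofPred.2 (by push_cast; linarith)) (Set.mem_ofPred.2 (by push_cast; linarith))
      (by push_cast; linarith)
    simpa using h
  · have h := Finset.sum_range_sub (fun k : ℕ => Real.log (k + 3 : ℕ) / (k + 3 : ℕ)) n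
    have hpos : 0 ≤ Real.log (n + 3 : ℕ) / (n + 3 : ℕ) :=
      div_nonneg (Real.log_natCast_nonneg _) (Nat.cast_nonneg _)
    rw [Finset.sum_neg_distrib, show ∑ k ∈ Finset.range n, (Real.log (k + 3 + 1 : ℕ) /
      (k + 3 + 1 : ℕ) - Real.log (k + 3 : ℕ) / (k + 3 : ℕ)) = _ from
        (Finset.sum_congr rfl fun k _ => by rw [show k + 3 + 1 = k + 1 + 3 by ring]).trans h]
    simp only [zero_add, Nat.cast_ofNat]
    linarith

lemma summable_int_log_div_sub_log_div :
    Summable fun n : ℤ => Real.log n / n - Real.log (n - 1 : ℤ) / (n - 1 : ℤ) := by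
  refine Summable.of_nat_of_neg_add_one ?_ ?_
  · rw [← summable_nat_add_iff 1]
    refine summable_log_div_sub_log_div.congr fun n => ?_
    push_cast
    rw [add_sub_cancel_right]
  · refine ((summable_nat_add_iff 1).2 summable_log_div_sub_log_div).congr fun n => ?_
    push_cast
    rw [show (-((n : ℝ) + 1) - 1) = -(n + 1 + 1) by ring, Real.log_neg_eq_log,
      Real.log_neg_eq_log, div_neg, div_neg]
    ring

/-- Summation by parts for the symmetric partial sums of a Fourier series. -/
lemma sum_range_sub_mul_zpow {K : Type*} [Field K] (h : ℤ → K) {E : K} (hE : E ≠ 0) (N : ℕ) :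
    ∑ n ∈ Finset.range N, ((h n - h (n - 1)) * E ^ (n : ℤ)
        + (h (-(n + 1)) - h (-(n + 1) - 1)) * E ^ (-(n + 1 : ℤ)))
      = (1 - E) * ∑ n ∈ Finset.range N,
          (h (n + 1) * E ^ (n + 1 : ℤ) + h (-(n + 1)) * E ^ (-(n + 1 : ℤ)))
        + ((1 - E) * (h 0 - h N * E ^ (N : ℤ)) + h (N - 1) * E ^ (N : ℤ)
          - h (-(N + 1)) * E ^ (-(N : ℤ))) := by
  induction N with
  | zero => simp
  | succ N ih =>
    rw [Finset.sum_range_succ, Finset.sum_range_succ, ih]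
    have h1 : E ^ (-(N : ℤ)) = E ^ (-(N + 1 : ℤ)) * E := by
      rw [← zpow_add_one₀ hE]
      congr 1
      ring
    push_cast
    rw [zpow_add_one₀ hE, h1, add_sub_cancel_right,
      show -((N : ℤ) + 1) - 1 = -(N + 1 + 1) by ring]
    ring

lemma hasSum_sub_smul_fourier {u : ℝ} (hu : u ∈ Set.Ico (0 : ℝ) 1) :
    HasSum (fun n : ℤ => (-(Complex.I / 2) *
        ((Real.log n / n : ℝ) - (Real.log (n - 1 : ℤ) / (n - 1 : ℤ) : ℝ))) *
          fourier n (u : AddCircle (1 : ℝ)))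
      ((1 - fourier 1 (u : AddCircle (1 : ℝ))) * (oddLogGamma u : ℂ)) := by
  have hend : (1 - fourier 1 ((0 : ℝ) : AddCircle (1 : ℝ))) * (oddLogGamma 0 : ℂ)
      = (1 - fourier 1 ((1 : ℝ) : AddCircle (1 : ℝ))) * (oddLogGamma 1 : ℂ) := by
    rw [AddCircle.coe_period, QuotientAddGroup.mk_zero]
    simp
  let B : C(AddCircle (1 : ℝ), ℂ) := ⟨AddCircle.liftIco 1 0
    fun x : ℝ => (1 - fourier 1 (x : AddCircle (1 : ℝ))) * (oddLogGamma x : ℂ),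
    AddCircle.liftIco_zero_continuous hend continuousOn_one_sub_fourier_mul_oddLogGamma⟩
  have hc : ∀ n, fourierCoeff B n = -(Complex.I / 2) *
      ((Real.log n / n : ℝ) - (Real.log (n - 1 : ℤ) / (n - 1 : ℤ) : ℝ)) :=
    fourierCoeff_one_sub_fourier_mul_oddLogGamma
  have hs : Summable (fourierCoeff B) := by
    refine ((Complex.hasSum_ofReal.mpr summable_int_log_div_sub_log_div.hasSum).summable.mul_left
      (-(Complex.I / 2))).congr fun n => ?_
    rw [hc]
    push_cast
    rfl
  have h := has_pointwise_sum_fourier_series_of_summable hs (u : AddCircle (1 : ℝ))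
  simp only [hc, smul_eq_mul] at h
  have hB : B (u : AddCircle (1 : ℝ))
      = (1 - fourier 1 (u : AddCircle (1 : ℝ))) * (oddLogGamma u : ℂ) :=
    AddCircle.liftIco_zero_coe_apply (f := fun x : ℝ =>
      (1 - fourier 1 (x : AddCircle (1 : ℝ))) * (oddLogGamma x : ℂ)) hu
  rwa [hB] at h

lemma fourier_coe_eq_zpow (n : ℤ) (u : ℝ) :
    fourier n (u : AddCircle (1 : ℝ)) = Complex.exp (2 * Real.pi * u * Complex.I) ^ n := by
  rw [fourier_coe_apply, ← Complex.exp_int_mul]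
  congr 1
  push_cast
  ring

lemma exp_two_pi_mul_I_ne_one {u : ℝ} (hu0 : 0 < u) (hu1 : u < 1) :
    Complex.exp (2 * Real.pi * u * Complex.I) ≠ 1 := by
  intro h
  obtain ⟨n, hn⟩ := Complex.exp_eq_one_iff.1 h
  have hun : (u : ℂ) = n := by
    have h2 : (2 * Real.pi * Complex.I : ℂ) ≠ 0 := Complex.two_pi_I_ne_zero
    refine mul_left_cancel₀ h2 ?_
    rw [mul_comm _ (n : ℂ), ← hn]
    ring
  have hun' : u = n := by exact_mod_cast hun
  rw [hun'] at hu0 hu1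
  have h0 : 0 < n := by exact_mod_cast hu0
  have h1 : n < 1 := by exact_mod_cast hu1
  omega

lemma tendsto_sum_log_mul_sin {u : ℝ} (hu0 : 0 < u) (hu1 : u < 1) :
    Tendsto (fun N : ℕ => ∑ n ∈ Finset.range N,
      Real.log (n + 1) * Real.sin (2 * Real.pi * (n + 1) * u) / (n + 1)) atTop
      (𝓝 (oddLogGamma u)) := by
  set E := Complex.exp (2 * Real.pi * u * Complex.I) with hEdef
  have hE : E ≠ 0 := Complex.exp_ne_zero _
  have hE1 : 1 - E ≠ 0 := sub_ne_zero.2 (exp_two_pi_mul_I_ne_one hu0 hu1).symm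
  have hnorm : ‖E‖ = 1 := by
    rw [hEdef]
    exact_mod_cast Complex.norm_exp_ofReal_mul_I (2 * Real.pi * u)
  clear_value E
  obtain ⟨h, hh⟩ : ∃ h : ℤ → ℂ, ∀ n, h n = -(Complex.I / 2) * (Real.log n / n : ℝ) :=
    ⟨_, fun _ => rfl⟩
  have hpos : Tendsto (fun N : ℕ => h N) atTop (𝓝 0) := by
    have := ((Complex.continuous_ofReal.tendsto 0).comp tendsto_log_div_natCast).const_mul
      (-(Complex.I / 2))
    simpa [hh, Function.comp_def] using this
  have hneg : ∀ n : ℤ, h (-n) = -h n := by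
    intro n
    simp [hh, Real.log_neg_eq_log, div_neg]
  have hbd : ∀ {f : ℕ → ℂ} (m : ℕ → ℤ), Tendsto f atTop (𝓝 0) →
      Tendsto (fun N => f N * E ^ m N) atTop (𝓝 0) := by
    intro f m hf
    rw [tendsto_zero_iff_norm_tendsto_zero] at hf ⊢
    simpa [hnorm] using hf
  have hT : Tendsto (fun N : ℕ => (1 - E) * (h 0 - h N * E ^ (N : ℤ)) + h (N - 1) * E ^ (N : ℤ)
      - h (-(N + 1)) * E ^ (-(N : ℤ))) atTop (𝓝 0) := by
    have h0 : h 0 = 0 := by simp [hh]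
    have hsucc : Tendsto (fun N : ℕ => h (-(N + 1))) atTop (𝓝 0) := by
      simp only [hneg]
      simpa using (hpos.comp (tendsto_add_atTop_nat 1)).neg
    have hpred : Tendsto (fun N : ℕ => h (N - 1)) atTop (𝓝 0) := by
      rw [← tendsto_add_atTop_iff_nat 1]
      simpa using hpos
    have h1 : Tendsto (fun N : ℕ => (1 - E) * (h 0 - h N * E ^ (N : ℤ))) atTop (𝓝 0) := by
      simpa only [h0, sub_zero, mul_zero] using
        ((hbd (fun N => (N : ℤ)) hpos).const_sub (h 0)).const_mul (1 - E)
    have h2 := (h1.add (hbd (fun N => (N : ℤ)) hpred)).sub (hbd (fun N => -(N : ℤ)) hsucc)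
    rwa [add_zero, sub_zero] at h2
  have hsum := hasSum_sub_smul_fourier ⟨hu0.le, hu1⟩
  simp only [fourier_coe_eq_zpow, zpow_one, ← hEdef] at hsum
  have hsum' : HasSum (fun n : ℤ => (h n - h (n - 1)) * E ^ n)
      ((1 - E) * (oddLogGamma u : ℂ)) := by
    simpa only [hh, mul_sub] using hsum
  have hlim := hsum'.nat_add_neg_add_one.tendsto_sum_nat
  have hlim' : Tendsto (fun N : ℕ => (1 - E) * ∑ n ∈ Finset.range N,
      (h (n + 1) * E ^ (n + 1 : ℤ) + h (-(n + 1)) * E ^ (-(n + 1 : ℤ)))) atTop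
      (𝓝 ((1 - E) * (oddLogGamma u : ℂ))) := by
    have := hlim.sub hT
    rw [sub_zero] at this
    refine this.congr fun N => ?_
    rw [sub_eq_iff_eq_add, ← sum_range_sub_mul_zpow h hE N]
  have hlim'' := hlim'.const_mul (1 - E)⁻¹
  simp only [inv_mul_cancel_left₀ hE1] at hlim''
  rw [← Filter.tendsto_ofReal_iff]
  refine hlim''.congr fun N => ?_
  push_cast
  refine Finset.sum_congr rfl fun n _ => ?_
  rw [hneg, Complex.sin]
  have hz : E ^ (n + 1 : ℤ) = Complex.exp (2 * Real.pi * (n + 1) * u * Complex.I) := by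
    rw [hEdef, ← Complex.exp_int_mul]
    congr 1
    push_cast
    ring
  rw [zpow_neg, hz, ← Complex.exp_neg]
  simp only [hh, neg_mul]
  push_cast
  ring

end Summation

end

open Real Complex Filter Topology Finset

/-- **Kummer's Fourier series for `log Γ`.** For `0 < u < 1`, the series
`∑_{n=1}^∞ (log n) sin(2πnu)/n` converges, with sum `S` say, and
`log Γ(u) = (1/2) log π + (1/π) S - (u - 1/2)(γ + log(2π)) - (1/2) log sin(πu)`. -/
theorem kummer_fourier_log_Gamma (u : ℝ) (hu0 : 0 < u) (hu1 : u < 1) :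
    ∃ S : ℝ,
      Tendsto (fun N : ℕ => ∑ n ∈ range N,
          Real.log (n + 1) * Real.sin (2 * π * (n + 1) * u) / (n + 1)) atTop (𝓝 S)
      ∧ Real.log (Real.Gamma u)
          = (1 / 2) * Real.log π + (1 / π) * S
            - (u - 1 / 2) * (Real.eulerMascheroniConstant + Real.log (2 * π))
            - (1 / 2) * Real.log (Real.sin (π * u)) := by
  refine ⟨oddLogGamma u, tendsto_sum_log_mul_sin hu0 hu1, ?_⟩
  have hsin : 0 < Real.sin (π * u) :=
    Real.sin_pos_of_pos_of_lt_pi (by positivity) (by nlinarith [Real.pi_pos])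
  have hrefl := congrArg Real.log (Real.Gamma_mul_Gamma_one_sub u)
  rw [Real.log_mul (Real.Gamma_pos_of_pos hu0).ne' (Real.Gamma_pos_of_pos (by linarith)).ne',
    Real.log_div Real.pi_ne_zero hsin.ne'] at hrefl
  rw [oddLogGamma, ← mul_assoc, one_div_mul_cancel Real.pi_ne_zero]
  linarith
end

section
/- The convergent series ∑_{n=0}^∞ ((−1)^{n+1}/(2n+1)!) ζ'(−2n−1) π^{2n+1} equals (γ + log π)/π, where ζ'(−2n−1) denotes the derivative of the Riemann zeta function at −2n−1 and γ is the Euler–Mascheroni constant. -/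
open Real Complex Filter Topology

/-- Interchange of summation for a nonnegative double series. -/
lemma HasSum.swap_of_nonneg {F : ℕ → ℕ → ℝ} {g h : ℕ → ℝ} {S : ℝ} (hF : ∀ i j, 0 ≤ F i j)
    (hg : ∀ i, HasSum (F i) (g i)) (hS : HasSum g S) (hh : ∀ j, HasSum (fun i ↦ F i j) (h j)) :
    HasSum h S := by
  have hsum : Summable (fun p : ℕ × ℕ ↦ F p.1 p.2) := by
    rw [summable_prod_of_nonneg fun p ↦ hF p.1 p.2]
    exact ⟨fun i ↦ (hg i).summable, by simpa only [(hg _).tsum_eq] using hS.summable⟩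
  have h1 : HasSum (fun p : ℕ × ℕ ↦ F p.1 p.2) S :=
    hS.unique (hsum.hasSum.prod_fiberwise hg) ▸ hsum.hasSum
  exact ((Equiv.prodComm ℕ ℕ).hasSum_iff.2 h1).prod_fiberwise hh

lemma hasSum_harmonic_mul_pow {x : ℝ} (hx : |x| < 1) :
    HasSum (fun n : ℕ ↦ (harmonic (n + 1) : ℝ) * x ^ (n + 1)) (-Real.log (1 - x) / (1 - x)) := by
  have h1 := Real.hasSum_pow_div_log_of_abs_lt_one hx
  have h2 := hasSum_geometric_of_abs_lt_one hx
  have := hasSum_sum_range_mul_of_summable_norm h1.summable.norm h2.summable.norm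
  rw [h1.tsum_eq, h2.tsum_eq, ← div_eq_mul_inv] at this
  convert! this using 2 with n
  rw [harmonic]
  push_cast
  rw [Finset.sum_mul]
  refine Finset.sum_congr rfl fun k hk ↦ ?_
  have hk' : n + 1 = (k + 1) + (n - k) := by have := Finset.mem_range.1 hk; omega
  rw [hk', pow_add]
  ring

lemma hasSum_harmonic_odd_mul_pow {x : ℝ} (hx : |x| < 1) :
    HasSum (fun n : ℕ ↦ (harmonic (2 * n + 1) : ℝ) * x ^ (2 * n + 2))
      (x / 2 * (Real.log (1 + x) / (1 + x) - Real.log (1 - x) / (1 - x))) := by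
  have h1 := hasSum_harmonic_mul_pow hx
  have h2 := hasSum_harmonic_mul_pow (x := -x) (by simpa using hx)
  have h3 := (h1.sub h2).mul_left (x / 2)
  have hinj : Function.Injective (fun n : ℕ ↦ 2 * n) := fun a b h ↦ by
    dsimp only at h; omega
  rw [← hinj.hasSum_iff] at h3
  · convert! h3 using 1
    · ext n
      have : Odd (2 * n + 1) := ⟨n, rfl⟩
      simp only [Function.comp_apply, this.neg_pow]
      ring
    · simp only [sub_neg_eq_add]
      ring
  · intro n hn
    have : Even (n + 1) := by
      rw [Nat.even_add_one, Nat.not_even_iff_odd]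
      by_contra h
      rw [Nat.not_odd_iff_even] at h
      obtain ⟨k, rfl⟩ := h
      exact hn ⟨k, by dsimp only; ring⟩
    simp [this.neg_pow]

lemma abs_one_div_two_mul_lt_one (j : ℕ) : |(1 / (2 * ((j : ℝ) + 1)))| < 1 := by
  rw [abs_of_pos (by positivity), div_lt_one (by positivity)]
  linarith [(Nat.cast_nonneg j : (0 : ℝ) ≤ j)]

lemma hasSum_pow_half_inv (j : ℕ) :
    HasSum (fun n : ℕ ↦ (1 / (2 * ((j : ℝ) + 1))) ^ (2 * n + 2))
      (1 / (4 * ((j : ℝ) + 1) ^ 2 - 1)) := by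
  have hj : (0 : ℝ) ≤ j := Nat.cast_nonneg j
  have h := (hasSum_geometric_of_lt_one (r := (1 / (2 * ((j : ℝ) + 1))) ^ 2) (by positivity)
    ((sq_lt_one_iff_abs_lt_one _).2 (abs_one_div_two_mul_lt_one j))).mul_left
      ((1 / (2 * ((j : ℝ) + 1))) ^ 2)
  convert! h using 1
  · ext n; ring
  · have h1 : 4 * ((j : ℝ) + 1) ^ 2 - 1 ≠ 0 := by nlinarith
    have h2 : 1 - (1 / (2 * ((j : ℝ) + 1))) ^ 2
        = (4 * ((j : ℝ) + 1) ^ 2 - 1) / (2 * (j + 1)) ^ 2 := by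
      field
    rw [h2, inv_div, div_pow, one_pow]
    field

lemma hasSum_harmonic_odd_mul_pow_half_inv (j : ℕ) :
    HasSum (fun n : ℕ ↦ (harmonic (2 * n + 1) : ℝ) * (1 / (2 * ((j : ℝ) + 1))) ^ (2 * n + 2))
      ((Real.log (2 * ((j + 1 : ℕ) : ℝ) + 1) / (2 * ((j + 1 : ℕ) : ℝ) + 1)
          - Real.log (2 * (j : ℝ) + 1) / (2 * j + 1)) / 2
        + Real.log 2 * (1 / (4 * ((j : ℝ) + 1) ^ 2 - 1))
        + Real.log (j + 1) * (1 / (4 * ((j : ℝ) + 1) ^ 2 - 1))) := by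
  have hj : (0 : ℝ) ≤ j := Nat.cast_nonneg j
  convert! hasSum_harmonic_odd_mul_pow (abs_one_div_two_mul_lt_one j) using 1
  have e1 : 1 + 1 / (2 * ((j : ℝ) + 1)) = (2 * (j + 1 : ℝ) + 1) / (2 * (j + 1)) := by field
  have e2 : 1 - 1 / (2 * ((j : ℝ) + 1)) = (2 * j + 1) / (2 * (j + 1)) := by field_simp; ring
  have e3 : 4 * ((j : ℝ) + 1) ^ 2 - 1 = (2 * j + 1) * (2 * (j + 1) + 1) := by ring
  rw [e1, e2, e3, Real.log_div (by positivity) (by positivity),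
    Real.log_div (by positivity) (by positivity), Real.log_mul (by positivity) (by positivity)]
  push_cast
  field_simp
  ring

lemma hasSum_one_div_four_mul_sq_sub_one :
    HasSum (fun j : ℕ ↦ 1 / (4 * ((j : ℝ) + 1) ^ 2 - 1)) (1 / 2) := by
  rw [hasSum_iff_tendsto_nat_of_nonneg]
  · have h (n : ℕ) : ∑ j ∈ Finset.range n, 1 / (4 * ((j : ℝ) + 1) ^ 2 - 1)
        = 1 / 2 - 1 / 2 * (1 / (2 * (n : ℝ) + 1)) := by
      induction n with
      | zero => simp
      | succ n ih =>
        rw [Finset.sum_range_succ, ih]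
        have e3 : 4 * ((n : ℝ) + 1) ^ 2 - 1 = (2 * n + 1) * (2 * (n + 1) + 1) := by ring
        rw [e3]
        push_cast
        field_simp
        ring
    simp_rw [h]
    have : Tendsto (fun n : ℕ ↦ 1 / (2 * (n : ℝ) + 1)) atTop (𝓝 0) := by
      simp_rw [one_div]
      exact tendsto_inv_atTop_zero.comp (tendsto_atTop_add_const_right _ _
        (tendsto_natCast_atTop_atTop.const_mul_atTop two_pos))
    convert! (this.const_mul (1 / 2)).const_sub (1 / 2) using 2
    simp
  · intro j
    have hj : (0 : ℝ) ≤ j := Nat.cast_nonneg j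
    have : 0 ≤ 4 * ((j : ℝ) + 1) ^ 2 - 1 := by nlinarith
    positivity

lemma LSeries_term_one_two_mul_add_two (n j : ℕ) :
    LSeries.term 1 (2 * (n : ℂ) + 2) (j + 1) =
    ((1 / ((j : ℝ) + 1) ^ (2 * n + 2) : ℝ) : ℂ) := by
  rw [LSeries.term_of_ne_zero (by omega)]
  have : (2 * (n : ℂ) + 2) = ((2 * n + 2 : ℕ) : ℂ) := by push_cast; rfl
  rw [this, Complex.cpow_natCast]
  push_cast
  simp

lemma LSeries_term_logMul_one_two_mul_add_two (n j : ℕ) :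
    LSeries.term (LSeries.logMul 1) (2 * (n : ℂ) + 2) (j + 1) =
      ((Real.log (j + 1) / ((j : ℝ) + 1) ^ (2 * n + 2) : ℝ) : ℂ) := by
  rw [LSeries.term_of_ne_zero (by omega)]
  have : (2 * (n : ℂ) + 2) = ((2 * n + 2 : ℕ) : ℂ) := by push_cast; rfl
  rw [this, Complex.cpow_natCast, LSeries.logMul]
  push_cast
  simp [Complex.ofReal_log (by positivity : (0 : ℝ) ≤ (j : ℝ) + 1)]

lemma one_lt_re_two_mul_add_two (n : ℕ) : 1 < (2 * (n : ℂ) + 2).re := by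
  simp; linarith [(Nat.cast_nonneg n : (0 : ℝ) ≤ n)]

lemma LSeriesHasSum.hasSum_term_succ {f : ℕ → ℂ} {s a : ℂ} (h : LSeriesHasSum f s a) :
    HasSum (fun j : ℕ ↦ LSeries.term f s (j + 1)) a := by
  simpa using (hasSum_nat_add_iff' (f := LSeries.term f s) 1).2 h

lemma hasSum_riemannZeta_two_mul_add_two (n : ℕ) :
    HasSum (fun j : ℕ ↦ ((1 / ((j : ℝ) + 1) ^ (2 * n + 2) : ℝ) : ℂ))
      (riemannZeta (2 * (n : ℂ) + 2)) := by
  simp_rw [← LSeries_term_one_two_mul_add_two]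
  exact LSeriesHasSum.hasSum_term_succ (LSeriesHasSum_one (one_lt_re_two_mul_add_two n))

lemma hasSum_neg_deriv_riemannZeta_two_mul_add_two (n : ℕ) :
    HasSum (fun j : ℕ ↦ ((Real.log (j + 1) / ((j : ℝ) + 1) ^ (2 * n + 2) : ℝ) : ℂ))
      (-deriv riemannZeta (2 * (n : ℂ) + 2)) := by
  simp_rw [← LSeries_term_logMul_one_two_mul_add_two]
  have habs : LSeries.abscissaOfAbsConv 1 < (2 * (n : ℂ) + 2).re := by
    rw [LSeries.abscissaOfAbsConv_one]
    exact_mod_cast one_lt_re_two_mul_add_two n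
  have hd : deriv riemannZeta (2 * (n : ℂ) + 2) = deriv (LSeries 1) (2 * (n : ℂ) + 2) := by
    refine Filter.EventuallyEq.deriv_eq ?_
    filter_upwards [(isOpen_lt continuous_const Complex.continuous_re).mem_nhds
      (one_lt_re_two_mul_add_two n)]
      with s hs using (LSeries_one_eq_riemannZeta hs).symm
  rw [hd, LSeries_deriv habs, neg_neg]
  exact LSeriesHasSum.hasSum_term_succ (LSeriesSummable_logMul_of_lt_re habs).LSeriesHasSum

/-- The derivative of the functional equation of `ζ` at a positive even integer. -/
lemma deriv_riemannZeta_neg_odd (n : ℕ) :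
    deriv riemannZeta (-(2 * (n : ℂ) + 1)) =
      2 * (-1) ^ n * (2 * (π : ℂ)) ^ (-(2 * (n : ℂ) + 2)) * ((2 * n + 1).factorial : ℂ) *
        ((harmonic (2 * n + 1) - Real.eulerMascheroniConstant - Real.log (2 * π)) *
          riemannZeta (2 * (n : ℂ) + 2) + deriv riemannZeta (2 * (n : ℂ) + 2)) := by
  set s : ℂ := 2 * (n : ℂ) + 2 with hs
  have hs1 : s ≠ 1 := fun h ↦ by
    have := one_lt_re_two_mul_add_two n
    rw [← hs, h] at this
    simp at this
  have hone : 1 - s = -(2 * (n : ℂ) + 1) := by rw [hs]; ring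
  have hre : 1 < s.re := one_lt_re_two_mul_add_two n
  have hne : 1 - s ≠ 1 := fun h ↦ by
    have : s = 0 := by linear_combination -h
    rw [this] at hre; norm_num at hre
  have hL : HasDerivAt (fun z ↦ riemannZeta (1 - z)) (-deriv riemannZeta (1 - s)) s := by
    have := (differentiableAt_riemannZeta hne).hasDerivAt.comp s ((hasDerivAt_id s).const_sub 1)
    simpa [Function.comp_def] using this
  have hG : HasDerivAt Complex.Gamma
      ((2 * n + 1).factorial * (-Real.eulerMascheroniConstant + harmonic (2 * n + 1))) s := by
    have := Complex.hasDerivAt_Gamma_nat (2 * n + 1)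
    convert! this using 1
    rw [hs]; push_cast; ring
  have hGv : Complex.Gamma s = (2 * n + 1).factorial := by
    rw [← Complex.Gamma_nat_eq_factorial]
    congr 1; rw [hs]; push_cast; ring
  have h2pi : (2 * (π : ℂ)) ≠ 0 := by simp [Real.pi_ne_zero]
  have hp : HasDerivAt (fun z ↦ (2 * (π : ℂ)) ^ (-z))
      (-(2 * (π : ℂ)) ^ (-s) * Real.log (2 * π)) s := by
    have := (hasDerivAt_neg' s).const_cpow (c := 2 * (π : ℂ)) (Or.inl h2pi)
    convert! this using 1
    rw [Complex.ofReal_log (by positivity)]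
    push_cast; ring
  have hang : (π : ℂ) * s / 2 = ((n + 1 : ℕ) : ℂ) * π := by rw [hs]; push_cast; ring
  have hcosv : Complex.cos (π * s / 2) = (-1) ^ (n + 1) := by
    rw [hang]
    exact_mod_cast congrArg ((↑) : ℝ → ℂ) (Real.cos_nat_mul_pi (n + 1))
  have hcos : HasDerivAt (fun z : ℂ ↦ Complex.cos (π * z / 2)) 0 s := by
    have := (((hasDerivAt_id s).const_mul (π : ℂ)).div_const 2).ccos
    convert! this using 1
    simp only [id]
    rw [hang, Complex.sin_nat_mul_pi]; simp
  have hz := (differentiableAt_riemannZeta hs1).hasDerivAt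
  have hR := (((hp.const_mul 2).mul hG).mul hcos).mul hz
  have heq : (fun z ↦ riemannZeta (1 - z)) =ᶠ[𝓝 s]
      fun z ↦ 2 * (2 * (π : ℂ)) ^ (-z) * Complex.Gamma z * Complex.cos (π * z / 2)
        * riemannZeta z := by
    filter_upwards [(isOpen_lt continuous_const Complex.continuous_re).mem_nhds hre] with z hz
    refine riemannZeta_one_sub (fun m h ↦ ?_) (fun h ↦ ?_)
    · rw [h] at hz
      simp at hz
      linarith [(Nat.cast_nonneg m : (0 : ℝ) ≤ m)]
    · rw [h] at hz; simp at hz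
  have := hL.unique (hR.congr_of_eventuallyEq heq)
  rw [hone] at this
  simp only [Pi.mul_apply, hcosv, hGv] at this
  linear_combination (-1) * this

lemma summable_log_mul_one_div_four_mul_sq_sub_one :
    Summable (fun j : ℕ ↦ Real.log (j + 1) * (1 / (4 * ((j : ℝ) + 1) ^ 2 - 1))) := by
  have h := (Complex.summable_ofReal.1 (hasSum_neg_deriv_riemannZeta_two_mul_add_two 0).summable)
  refine h.of_nonneg_of_le (fun j ↦ ?_) (fun j ↦ ?_)
  all_goals
    have hj : (0 : ℝ) ≤ j := Nat.cast_nonneg j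
    have hl : 0 ≤ Real.log (j + 1) := Real.log_nonneg (by linarith)
    have hp : 0 < 4 * ((j : ℝ) + 1) ^ 2 - 1 := by nlinarith
  · positivity
  · rw [mul_one_div]
    gcongr
    norm_num
    nlinarith

lemma tendsto_log_div_two_mul_add_one :
    Tendsto (fun n : ℕ ↦ Real.log (2 * (n : ℝ) + 1) / (2 * n + 1)) atTop (𝓝 0) := by
  have h : Tendsto (fun x : ℝ ↦ Real.log x / x) atTop (𝓝 0) :=
    Real.isLittleO_log_id_atTop.tendsto_div_nhds_zero
  exact h.comp (tendsto_atTop_add_const_right _ _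
    (tendsto_natCast_atTop_atTop.const_mul_atTop two_pos))

lemma pow_half_inv (n j : ℕ) : (1 / (2 * ((j : ℝ) + 1))) ^ (2 * n + 2)
    = 1 / 4 ^ (n + 1) * (1 / ((j : ℝ) + 1) ^ (2 * n + 2)) := by
  rw [show (4 : ℝ) = 2 ^ 2 by norm_num, ← pow_mul, div_pow, mul_pow, one_pow]
  rw [show 2 * (n + 1) = 2 * n + 2 by ring]
  field

/-- The sum over `n` of the combination of `ζ(2n+2)` and `ζ'(2n+2)` in the functional equation. -/
lemma hasSum_harmonic_zeta :
    HasSum (fun n : ℕ ↦ 1 / (4 : ℂ) ^ (n + 1) *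
      ((harmonic (2 * n + 1) - Real.eulerMascheroniConstant - Real.log (2 * π)) *
          riemannZeta (2 * (n : ℂ) + 2) + deriv riemannZeta (2 * (n : ℂ) + 2)))
      ((-(Real.eulerMascheroniConstant + Real.log π) / 2 : ℝ) : ℂ) := by
  set Z : ℕ → ℝ := fun n ↦ ∑' j : ℕ, 1 / ((j : ℝ) + 1) ^ (2 * n + 2)
  set L : ℕ → ℝ := fun n ↦ ∑' j : ℕ, Real.log (j + 1) / ((j : ℝ) + 1) ^ (2 * n + 2)
  set T : ℝ := ∑' j : ℕ, Real.log (j + 1) * (1 / (4 * ((j : ℝ) + 1) ^ 2 - 1))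
  have hZ (n : ℕ) : HasSum (fun j : ℕ ↦ 1 / ((j : ℝ) + 1) ^ (2 * n + 2)) (Z n) :=
    (Complex.summable_ofReal.1 (hasSum_riemannZeta_two_mul_add_two n).summable).hasSum
  have hL (n : ℕ) : HasSum (fun j : ℕ ↦ Real.log (j + 1) / ((j : ℝ) + 1) ^ (2 * n + 2)) (L n) :=
    (Complex.summable_ofReal.1 (hasSum_neg_deriv_riemannZeta_two_mul_add_two n).summable).hasSum
  have hT : HasSum (fun j : ℕ ↦ Real.log (j + 1) * (1 / (4 * ((j : ℝ) + 1) ^ 2 - 1))) T :=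
    summable_log_mul_one_div_four_mul_sq_sub_one.hasSum
  have hlog (j : ℕ) : 0 ≤ Real.log ((j : ℝ) + 1) :=
    Real.log_nonneg (by linarith [(Nat.cast_nonneg j : (0 : ℝ) ≤ j)])
  have hharm (n : ℕ) : (0 : ℝ) ≤ harmonic n := by
    rw [harmonic]
    positivity
  have hC : HasSum (fun n ↦ 1 / 4 ^ (n + 1) * Z n) (1 / 2) :=
    HasSum.swap_of_nonneg (fun j n ↦ by positivity) hasSum_pow_half_inv
      hasSum_one_div_four_mul_sq_sub_one fun n ↦ by
        simp_rw [pow_half_inv]; exact (hZ n).mul_left _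
  have hB : HasSum (fun n ↦ 1 / 4 ^ (n + 1) * L n) T :=
    HasSum.swap_of_nonneg (fun j n ↦ mul_nonneg (hlog j) (by positivity))
      (fun j ↦ (hasSum_pow_half_inv j).mul_left (Real.log (j + 1))) hT fun n ↦ by
        convert! (hL n).mul_left (1 / 4 ^ (n + 1)) using 2 with j
        rw [pow_half_inv]
        ring
  have hA : HasSum (fun n ↦ 1 / 4 ^ (n + 1) * (harmonic (2 * n + 1) * Z n))
      (Real.log 2 * (1 / 2) + T) := by
    have hpos (j n : ℕ) :
        (0 : ℝ) ≤ harmonic (2 * n + 1) * (1 / (2 * ((j : ℝ) + 1))) ^ (2 * n + 2) :=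
      mul_nonneg (hharm _) (by positivity)
    refine HasSum.swap_of_nonneg hpos hasSum_harmonic_odd_mul_pow_half_inv ?_ fun n ↦ ?_
    · rw [hasSum_iff_tendsto_nat_of_nonneg
        fun j ↦ (hasSum_harmonic_odd_mul_pow_half_inv j).nonneg (hpos j)]
      simp_rw [Finset.sum_add_distrib, ← Finset.sum_div]
      simp_rw [Finset.sum_range_sub (fun n : ℕ ↦ Real.log (2 * (n : ℝ) + 1) / (2 * n + 1))]
      have h1 := (hasSum_one_div_four_mul_sq_sub_one.mul_left (Real.log 2)).tendsto_sum_nat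
      have h2 := (tendsto_log_div_two_mul_add_one.div_const 2).add h1 |>.add hT.tendsto_sum_nat
      simpa using h2
    · rw [← mul_assoc]
      convert! (hZ n).mul_left (1 / 4 ^ (n + 1) * (harmonic (2 * n + 1) : ℝ)) using 2 with j
      rw [pow_half_inv]
      ring
  have key := (hA.sub hB).sub
    (hC.mul_left (Real.eulerMascheroniConstant + Real.log (2 * π)))
  convert! Complex.hasSum_ofReal.2 key using 1
  · ext n
    have eZ : riemannZeta (2 * (n : ℂ) + 2) = (Z n : ℂ) :=
      (hasSum_riemannZeta_two_mul_add_two n).unique (Complex.hasSum_ofReal.2 (hZ n))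
    have eL : deriv riemannZeta (2 * (n : ℂ) + 2) = -(L n : ℂ) := by
      rw [← (hasSum_neg_deriv_riemannZeta_two_mul_add_two n).unique
        (Complex.hasSum_ofReal.2 (hL n)), neg_neg]
    rw [eZ, eL]
    push_cast
    ring
  · congr 1
    rw [Real.log_mul two_ne_zero Real.pi_ne_zero]
    ring

theorem hasSum_zeta_deriv_neg_odd_pi_pow :
    HasSum
      (fun n : ℕ => ((-1 : ℂ) ^ (n + 1) / (Nat.factorial (2 * n + 1) : ℂ))
        * deriv riemannZeta (-(2 * (n : ℂ) + 1)) * (π : ℂ) ^ (2 * n + 1))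
      (((Real.eulerMascheroniConstant + Real.log π) / π : ℝ) : ℂ) := by
  have hpi : (π : ℂ) ≠ 0 := by simp [Real.pi_ne_zero]
  convert! hasSum_harmonic_zeta.mul_left (-(2 / (π : ℂ))) using 1
  · ext n
    have hcast : 2 * (n : ℂ) + 2 = ((2 * n + 2 : ℕ) : ℂ) := by push_cast; rfl
    have hpow : (2 * (π : ℂ)) ^ (-(2 * (n : ℂ) + 2))
        = 1 / 4 ^ (n + 1) * (1 / π ^ (2 * n + 2)) := by
      rw [hcast, Complex.cpow_neg, Complex.cpow_natCast, mul_pow,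
        show (4 : ℂ) = 2 ^ 2 by norm_num, ← pow_mul, show 2 * (n + 1) = 2 * n + 2 by ring]
      field
    have hsign : (-1 : ℂ) ^ (n + 1) * (-1) ^ n = -1 := by
      rw [pow_succ, mul_right_comm, ← mul_pow]; simp
    have hfac : ((2 * n + 1).factorial : ℂ) ≠ 0 := by exact_mod_cast Nat.factorial_ne_zero _
    have hpip : (π : ℂ) ^ (2 * n + 1) / π ^ (2 * n + 2) = 1 / π := by
      rw [pow_succ _ (2 * n + 1)]; field
    rw [deriv_riemannZeta_neg_odd, hpow]
    generalize (harmonic (2 * n + 1) - Real.eulerMascheroniConstant - Real.log (2 * π)) *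
          riemannZeta (2 * (n : ℂ) + 2) + deriv riemannZeta (2 * (n : ℂ) + 2) = W
    calc _ = ((-1 : ℂ) ^ (n + 1) * (-1) ^ n) * 2 *
          (((2 * n + 1).factorial : ℂ) / (2 * n + 1).factorial) *
          ((π : ℂ) ^ (2 * n + 1) / π ^ (2 * n + 2)) * (1 / 4 ^ (n + 1) * W) := by ring
      _ = _ := by rw [hsign, hpip, div_self hfac]; ring
  · push_cast
    field
end
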